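/- Let f be a twist map with normalized lift f̃, let φ > 0, and suppose 0 is a regular value of F_φ viewed as a C¹ function on A. Call a connected component of the zero set Z = F_φ⁻¹(0) ⊆ A essential if, as an embedded circle, it is not null-homotopic in A (equivalently, it has winding number ±1 around the annulus). Then the number of essential connected components of Z is odd; in particular, Z has at least one essential component. -/

import Mathlib

open Set MeasureTheory

noncomputable section

/-- The cylinder `(ℝ/ℤ) × ℝ`, in which the standard annulus sits. -/
abbrev Cyl : Type := AddCircle (1 : ℝ) × ℝ

/-- The standard annulus `A = (ℝ/ℤ) × [0,1]`, viewed inside the cylinder. -/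
def annA : Set Cyl := Set.univ ×ˢ Set.Icc (0 : ℝ) 1

/-- The universal cover `Ã = ℝ × [0,1]`, viewed inside `ℝ²`. -/
def stripA : Set (ℝ × ℝ) := Set.univ ×ˢ Set.Icc (0 : ℝ) 1

/-- The covering projection `π(x, y) = (x mod 1, y)`. -/
def covProj (p : ℝ × ℝ) : Cyl := ((p.1 : AddCircle (1 : ℝ)), p.2)

/-- `F_φ(x,y) = φ·(f̃₁(x,y) − x) − (f̃₂(x,y) − y)`, for a lift `F = f̃`. -/
def Fphi (F : ℝ × ℝ → ℝ × ℝ) (φ : ℝ) (p : ℝ × ℝ) : ℝ :=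
  φ * ((F p).1 - p.1) - ((F p).2 - p.2)

/-- Since `F_φ` is 1-periodic in `x`, it descends to `A`; this is the zero set
`Z = F_φ⁻¹(0) ⊆ A` of the descended function. -/
def zeroSetA (F : ℝ × ℝ → ℝ × ℝ) (φ : ℝ) : Set Cyl :=
  covProj '' {p ∈ stripA | Fphi F φ p = 0}

/-- A subset `C` of the annulus is *essential* if it is the image of an injective loop in
`A` that is not null-homotopic in `A`. -/
def IsEssential (C : Set Cyl) : Prop :=
  ∃ γ : C(AddCircle (1 : ℝ), ↥annA),
    (Set.range fun t => ((γ t : Cyl))) = C ∧ Function.Injective ⇑γ ∧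
    ¬ γ.Nullhomotopic

/-- The set of essential connected components of the zero set `Z = F_φ⁻¹(0) ⊆ A`. -/
def essentialComponents (F : ℝ × ℝ → ℝ × ℝ) (φ : ℝ) : Set (Set Cyl) :=
  {C | (∃ z ∈ zeroSetA F φ, C = connectedComponentIn (zeroSetA F φ) z) ∧ IsEssential C}


section Helpers

open Filter Topology

/-- lifting of circle valued maps on simply connected spaces -/
lemma lift_circle {X : Type*} [TopologicalSpace X] [SimplyConnectedSpace X]
    [LocallyPathConnectedSpace X] (f : X → AddCircle (1 : ℝ)) (hf : Continuous f) :
    ∃ L : X → ℝ, Continuous L ∧ ∀ x, ((L x : ℝ) : AddCircle (1 : ℝ)) = f x := by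
  obtain ⟨a⟩ : Nonempty X := inferInstance
  obtain ⟨e, he⟩ := QuotientAddGroup.mk_surjective (f a)
  obtain ⟨F, ⟨-, hF⟩, -⟩ := (AddCircle.isCoveringMap_coe (1 : ℝ)).existsUnique_continuousMap_lifts
    ⟨f, hf⟩ a e he
  exact ⟨F, F.continuous, fun x => congrFun hF x⟩

lemma lift_log {X : Type*} [TopologicalSpace X] [SimplyConnectedSpace X]
    [LocallyPathConnectedSpace X] (f : X → ℂ) (hf : Continuous f) (h0 : ∀ x, f x ≠ 0) :
    ∃ L : X → ℂ, Continuous L ∧ ∀ x, Complex.exp (L x) = f x := by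
  obtain ⟨a⟩ : Nonempty X := inferInstance
  obtain ⟨F, ⟨-, hF⟩, -⟩ := Complex.isCoveringMap_exp.existsUnique_continuousMap_lifts
    ⟨fun x => (⟨f x, h0 x⟩ : {z : ℂ // z ≠ 0}), by fun_prop⟩ a (Complex.log (f a))
    (by ext; simp [Complex.exp_log (h0 a)])
  exact ⟨F, F.continuous, fun x => congrArg Subtype.val (congrFun hF x)⟩

lemma coe_circle_eq_iff (x y : ℝ) : (x : AddCircle (1 : ℝ)) = y ↔ ∃ n : ℤ, y = x + n := by
  rw [eq_comm, ← sub_eq_zero, ← AddCircle.coe_sub, AddCircle.coe_eq_zero_iff]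
  constructor
  · rintro ⟨n, hn⟩; exact ⟨n, by simp at hn; linarith⟩
  · rintro ⟨n, hn⟩; exact ⟨n, by simp; linarith⟩

lemma covProj_eq_iff (p q : ℝ × ℝ) : covProj p = covProj q ↔ ∃ n : ℤ, q = p + ((n : ℝ), 0) := by
  unfold covProj
  rw [Prod.mk.injEq, coe_circle_eq_iff]
  constructor
  · rintro ⟨⟨n, hn⟩, h⟩; exact ⟨n, by ext <;> simp [hn, h]⟩
  · rintro ⟨n, rfl⟩; exact ⟨⟨n, by simp⟩, by simp⟩

lemma covProj_continuous : Continuous covProj := by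
  unfold covProj
  have : Continuous ((↑) : ℝ → AddCircle (1 : ℝ)) := AddCircle.continuous_mk' 1
  fun_prop

lemma covProj_surjective : Function.Surjective covProj := by
  rintro ⟨a, y⟩
  obtain ⟨x, rfl⟩ := QuotientAddGroup.mk_surjective a
  exact ⟨(x, y), rfl⟩

lemma covProj_isOpenMap : IsOpenMap covProj := by
  have h1 : IsOpenMap ((↑) : ℝ → AddCircle (1 : ℝ)) := QuotientAddGroup.isOpenMap_coe
  exact h1.prodMap (IsOpenMap.id (X := ℝ))

/-- integer valued continuous real functions -/
lemma locconst_const (H : ℝ × ℝ → ℤ) (h : ∀ p, ∀ᶠ q in 𝓝 p, H q = H p) (p q : ℝ × ℝ) :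
    H p = H q := by
  have : IsLocallyConstant H := (IsLocallyConstant.iff_eventually_eq H).2 h
  exact this.apply_eq_of_preconnectedSpace p q

/-- the positive side indicator -/
def sgnI (g : ℝ × ℝ → ℝ) (q : ℝ × ℝ) : ℤ := if 0 < g q then 1 else 0

open Classical in
def Jump (g : ℝ × ℝ → ℝ) (K : Set (ℝ × ℝ)) (H : ℝ × ℝ → ℤ) : Prop :=
  ∀ p, ∀ᶠ q in 𝓝 p, H q - H p = if p ∈ K then sgnI g q else 0

lemma sgnI_loc {g : ℝ × ℝ → ℝ} (hg : Continuous g) {p : ℝ × ℝ} (hp : g p ≠ 0) :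
    ∀ᶠ q in 𝓝 p, sgnI g q = sgnI g p := by
  rcases lt_or_gt_of_ne hp with h | h
  · filter_upwards [hg.continuousAt.eventually_lt_const h] with q hq
    simp [sgnI, not_lt.2 h.le, not_lt.2 hq.le]
  · filter_upwards [hg.continuousAt.eventually_const_lt h] with q hq
    simp [sgnI, h, hq]

lemma sgnI_zero {g : ℝ × ℝ → ℝ} {p : ℝ × ℝ} (hp : g p = 0) : sgnI g p = 0 := by simp [sgnI, hp]

lemma jump_sgn {g : ℝ × ℝ → ℝ} (hg : Continuous g) : Jump g {q | g q = 0} (sgnI g) := by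
  intro p
  by_cases hp : g p = 0
  · simp [hp, sgnI_zero hp]
  · filter_upwards [sgnI_loc hg hp] with q hq
    simp [hp, hq]

lemma exists_jump {g : ℝ × ℝ → ℝ} (hg : Continuous g) {K : Set (ℝ × ℝ)} (hK : IsClosed K)
    (hKZ : K ⊆ {q | g q = 0}) (hK' : IsClosed ({q | g q = 0} \ K)) : ∃ H, Jump g K H := by
  classical
  obtain ⟨ψ, h0, h1, h01⟩ := exists_continuous_zero_one_of_isClosed hK hK' disjoint_sdiff_right
  let a : ℝ × ℝ → ℝ := fun q => (2 * sgnI g q - 1) * ψ q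
  -- basic facts
  have a_off : ∀ p, g p ≠ 0 → Tendsto a (𝓝 p) (𝓝 (a p)) := by
    intro p hp
    have : Tendsto (fun q => (2 * sgnI g p - 1) * ψ q) (𝓝 p) (𝓝 (a p)) :=
      (ψ.continuous.const_mul _).tendsto p
    refine this.congr' ?_
    filter_upwards [sgnI_loc hg hp] with q hq
    simp [a, hq]
  have habs : ∀ q, |a q| = |ψ q| := by
    intro q; simp only [a, abs_mul, sgnI]; split_ifs <;> norm_num
  have a_K : ∀ p ∈ K, Tendsto a (𝓝 p) (𝓝 0) := by
    intro p hp
    rw [tendsto_zero_iff_abs_tendsto_zero]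
    have : Tendsto (fun q => |ψ q|) (𝓝 p) (𝓝 |ψ p|) := (ψ.continuous.abs).tendsto p
    rw [h0 hp] at this
    simpa [Function.comp_def, habs] using this
  have a_K' : ∀ p, g p = 0 → p ∉ K → Tendsto (fun q => a q + 1 - 2 * sgnI g q) (𝓝 p) (𝓝 0) := by
    intro p hp hpK
    have hψ : ψ p = 1 := h1 ⟨hp, hpK⟩
    rw [tendsto_zero_iff_abs_tendsto_zero]
    have : Tendsto (fun q => |ψ q - 1|) (𝓝 p) (𝓝 |ψ p - 1|) :=
      ((ψ.continuous.sub continuous_const).abs).tendsto p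
    rw [hψ] at this
    simp only [sub_self, abs_zero] at this
    refine this.congr fun q => ?_
    have : a q + 1 - 2 * sgnI g q = (2 * sgnI g q - 1) * (ψ q - 1) := by simp only [a]; ring
    simp only [Function.comp_apply, this, abs_mul]
    simp only [sgnI]; split_ifs <;> norm_num
  have hcoe : Continuous ((↑) : ℝ → AddCircle (1 : ℝ)) := AddCircle.continuous_mk' 1
  have hcont : Continuous fun q => ((a q / 2 : ℝ) : AddCircle (1 : ℝ)) := by
    rw [continuous_iff_continuousAt]
    intro p
    by_cases hp : g p = 0
    · by_cases hpK : p ∈ K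
      · have hap : a p = 0 := by simp [a, h0 hpK]
        have := (a_K p hpK).div_const 2
        rw [← hap] at this
        exact (hcoe.tendsto _).comp this
      · have hap : a p = -1 := by simp [a, h1 ⟨hp, hpK⟩, sgnI_zero hp]
        have := ((a_K' p hp hpK).sub_const 1).div_const 2
        rw [zero_sub, ← hap] at this
        refine ((hcoe.tendsto _).comp this).congr fun q => ?_
        rw [Function.comp_apply, coe_circle_eq_iff]
        exact ⟨sgnI g q, by ring⟩
    · exact (hcoe.tendsto _).comp ((a_off p hp).div_const 2)
  obtain ⟨L, hL, hLa⟩ := lift_circle _ hcont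
  have : ∀ q, ∃ n : ℤ, L q = a q / 2 + n := fun q => (coe_circle_eq_iff _ _).1 (hLa q).symm
  choose n hn using this
  have small : ∀ m : ℤ, |(m : ℝ)| < 1 → m = 0 := by
    intro m hm
    exact Int.abs_lt_one_iff.1 (by exact_mod_cast hm)
  have key : ∀ p, ∀ᶠ q in 𝓝 p, |L q - L p| < 1 / 4 := by
    intro p
    have := (hL.tendsto p)
    rw [Metric.tendsto_nhds] at this
    simpa [Real.dist_eq] using this (1/4) (by norm_num)
  refine ⟨fun q => n q + sgnI g q, fun p => ?_⟩
  by_cases hp : g p = 0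
  · by_cases hpK : p ∈ K
    · have hap : a p = 0 := by simp [a, h0 hpK]
      have h2 := a_K p hpK
      rw [Metric.tendsto_nhds] at h2
      filter_upwards [key p, h2 (1/4) (by norm_num)] with q hq1 hq2
      have : n q - n p = 0 := by
        apply small
        push_cast
        rw [Real.dist_eq, sub_zero] at hq2
        rw [hn, hn, hap] at hq1
        rw [abs_lt] at *
        constructor <;> linarith
      simp [hpK, sgnI_zero hp]; omega
    · have hap : a p = -1 := by simp [a, h1 ⟨hp, hpK⟩, sgnI_zero hp]
      have h2 := a_K' p hp hpK
      rw [Metric.tendsto_nhds] at h2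
      filter_upwards [key p, h2 (1/4) (by norm_num)] with q hq1 hq2
      have : n q + sgnI g q - n p = 0 := by
        apply small
        push_cast
        rw [Real.dist_eq, sub_zero] at hq2
        rw [hn, hn, hap] at hq1
        rw [abs_lt] at *
        constructor <;> linarith
      simp [hpK, sgnI_zero hp]; omega
  · have hpK : p ∉ K := fun h => hp (hKZ h)
    have h2 := a_off p hp
    rw [Metric.tendsto_nhds] at h2
    filter_upwards [key p, h2 (1/4) (by norm_num), sgnI_loc hg hp] with q hq1 hq2 hq3
    have : n q - n p = 0 := by
      apply small
      push_cast
      rw [Real.dist_eq] at hq2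
      rw [hn, hn] at hq1
      rw [abs_lt] at *
      constructor <;> linarith
    simp [hpK, hq3]; omega

lemma Jump.sub_const {g : ℝ × ℝ → ℝ} {K : Set (ℝ × ℝ)} {H H' : ℝ × ℝ → ℤ} (h : Jump g K H)
    (h' : Jump g K H') (p q : ℝ × ℝ) : H p - H' p = H q - H' q := by
  refine locconst_const (fun q => H q - H' q) (fun p => ?_) p q
  filter_upwards [h p, h' p] with q h1 h2
  rw [← h2] at h1; omega

lemma Jump.add {g : ℝ × ℝ → ℝ} {K K' : Set (ℝ × ℝ)} {H H' : ℝ × ℝ → ℤ} (h : Jump g K H)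
    (h' : Jump g K' H') (hd : Disjoint K K') : Jump g (K ∪ K') (fun q => H q + H' q) := by
  classical
  intro p
  filter_upwards [h p, h' p] with q h1 h2
  by_cases hk : p ∈ K
  · have hk' : p ∉ K' := fun h => hd.le_bot ⟨hk, h⟩
    simp [hk, hk'] at *; omega
  · by_cases hk' : p ∈ K'
    · simp [hk, hk'] at *; omega
    · simp [hk, hk'] at *; omega

/-- `H` is constant on connected sets missing `K` -/
lemma Jump.const_on {g : ℝ × ℝ → ℝ} {K : Set (ℝ × ℝ)} {H : ℝ × ℝ → ℤ} (h : Jump g K H)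
    {S : Set (ℝ × ℝ)} (hS : IsPreconnected S) (hd : Disjoint S K) {p q : ℝ × ℝ} (hp : p ∈ S)
    (hq : q ∈ S) : H p = H q := by
  have hc : ContinuousOn H S := by
    intro p hp
    have hk : p ∉ K := fun h => hd.le_bot ⟨hp, h⟩
    have h1 := h p
    simp only [hk, if_false] at h1
    apply ContinuousAt.continuousWithinAt
    refine (continuousAt_const (y := H p)).congr ?_
    filter_upwards [h1] with q hq
    omega
  exact hS.constant hc hp hq

lemma Jump.low {g : ℝ × ℝ → ℝ} {K : Set (ℝ × ℝ)} {H : ℝ × ℝ → ℤ} (h : Jump g K H)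
    (hK : ∀ p ∈ K, 0 < p.2 ∧ p.2 < 1) (x x' : ℝ) : H (x, 0) = H (x', 0) := by
  refine h.const_on (S := univ ×ˢ {0}) (isPreconnected_univ.prod isPreconnected_singleton) ?_
    (by simp) (by simp)
  rw [Set.disjoint_left]
  rintro ⟨a, b⟩ hab hk
  have := hK _ hk
  simp at hab this; linarith

lemma Jump.high {g : ℝ × ℝ → ℝ} {K : Set (ℝ × ℝ)} {H : ℝ × ℝ → ℤ} (h : Jump g K H)
    (hK : ∀ p ∈ K, 0 < p.2 ∧ p.2 < 1) (x x' : ℝ) : H (x, 1) = H (x', 1) := by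
  refine h.const_on (S := univ ×ˢ {1}) (isPreconnected_univ.prod isPreconnected_singleton) ?_
    (by simp) (by simp)
  rw [Set.disjoint_left]
  rintro ⟨a, b⟩ hab hk
  have := hK _ hk
  simp at hab this; linarith

/-- If `K` misses a vertical line then no total jump. -/
lemma Jump.miss {g : ℝ × ℝ → ℝ} {K : Set (ℝ × ℝ)} {H : ℝ × ℝ → ℤ} (h : Jump g K H)
    (hK : ∀ p ∈ K, 0 < p.2 ∧ p.2 < 1) (x : ℝ) (hx : ∀ p ∈ K, p.1 ≠ x) :
    H (0, 1) = H (0, 0) := by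
  rw [h.high hK 0 x, h.low hK 0 x]
  refine h.const_on (S := {x} ×ˢ univ) (isPreconnected_singleton.prod isPreconnected_univ) ?_
    (by simp) (by simp)
  rw [Set.disjoint_left]
  rintro ⟨a, b⟩ hab hk
  have := hx _ hk
  simp at hab this; exact this hab

lemma Jump.periodic {g : ℝ × ℝ → ℝ} {K : Set (ℝ × ℝ)} {H : ℝ × ℝ → ℤ} (h : Jump g K H)
    (hK : ∀ p ∈ K, 0 < p.2 ∧ p.2 < 1) (n : ℤ) (hg : ∀ p, g (p + ((n : ℝ), 0)) = g p)
    (hKn : ∀ p, p + ((n : ℝ), 0) ∈ K ↔ p ∈ K) (p : ℝ × ℝ) : H (p + ((n : ℝ), 0)) = H p := by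
  have h' : Jump g K (fun q => H (q + ((n : ℝ), 0))) := by
    intro p
    have h1 := h (p + ((n : ℝ), 0))
    have : Tendsto (fun q : ℝ × ℝ => q + ((n : ℝ), (0 : ℝ))) (𝓝 p) (𝓝 (p + ((n : ℝ), 0))) :=
      (continuous_add_const _).tendsto p
    filter_upwards [this.eventually h1] with q hq
    rw [hq]
    by_cases hp : p ∈ K
    · simp [hp, (hKn p).2 hp, sgnI, hg]
    · simp [hp, mt (hKn p).1 hp]
  have h2 := h'.sub_const h p (0, 0)
  have h3 := h.low hK (n : ℝ) 0
  simp at h2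
  omega



structure Good (g : ℝ × ℝ → ℝ) : Prop where
  cont : Continuous g
  per : ∀ p, g (p + (1, 0)) = g p
  low : ∀ p : ℝ × ℝ, p.2 ≤ 0 → g p < 0
  high : ∀ p : ℝ × ℝ, 1 ≤ p.2 → 0 < g p
  smooth : ∀ p, g p = 0 → ContDiffAt ℝ 1 g p
  reg : ∀ p, g p = 0 → fderiv ℝ g p ≠ 0

lemma Good.perZ {g : ℝ × ℝ → ℝ} (hg : Good g) (n : ℤ) (p : ℝ × ℝ) :
    g (p + ((n : ℝ), 0)) = g p := by
  induction n using Int.induction_on generalizing p with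
  | zero => congr 1; ext <;> simp
  | succ i ih =>
    rw [← ih p, ← hg.per (p + (((i : ℤ) : ℝ), 0))]; congr 1; ext <;> simp; ring
  | pred i ih =>
    rw [← ih p, ← hg.per (p + _)]; congr 1; ext <;> simp; ring

lemma Good.strip {g : ℝ × ℝ → ℝ} (hg : Good g) {p : ℝ × ℝ} (hp : g p = 0) :
    0 < p.2 ∧ p.2 < 1 := by
  constructor
  · by_contra h; exact (hg.low p (not_lt.1 h)).ne hp
  · by_contra h; exact (hg.high p (not_lt.1 h)).ne' hp

def ZC (g : ℝ × ℝ → ℝ) : Set Cyl := covProj '' {p | g p = 0}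

lemma Good.mem_ZC {g : ℝ × ℝ → ℝ} (hg : Good g) (p : ℝ × ℝ) : covProj p ∈ ZC g ↔ g p = 0 := by
  constructor
  · rintro ⟨q, hq, h⟩
    obtain ⟨n, rfl⟩ := (covProj_eq_iff _ _).1 h
    rw [hg.perZ]; exact hq
  · intro h; exact ⟨p, h, rfl⟩

lemma nhds_covProj (p : ℝ × ℝ) : 𝓝 (covProj p) = map covProj (𝓝 p) :=
  (covProj_isOpenMap.map_nhds_eq covProj_continuous.continuousAt).symm

/-- two-valuedness of the jump function of a connected piece -/
lemma Jump.two {g : ℝ × ℝ → ℝ} (hg : Good g) {C : Set Cyl} (hC : IsPreconnected C)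
    (hCZ : C ⊆ ZC g) (hne : C.Nonempty) {H : ℝ × ℝ → ℤ} (h : Jump g (covProj ⁻¹' C) H) :
    ∃ c : ℤ, (∀ p, covProj p ∈ C → H p = c) ∧ ∀ q, H q = c ∨ H q = c + 1 := by
  have hK0 : ∀ p, covProj p ∈ C → g p = 0 := fun p hp => (hg.mem_ZC p).1 (hCZ hp)
  have hper : ∀ p q, covProj p = covProj q → H p = H q := by
    intro p q hpq
    obtain ⟨n, rfl⟩ := (covProj_eq_iff _ _).1 hpq
    symm
    apply h.periodic (fun p hp => hg.strip (hK0 p hp)) n (hg.perZ n)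
    intro p
    have : covProj (p + ((n : ℝ), 0)) = covProj p := ((covProj_eq_iff _ _).2 ⟨n, rfl⟩).symm
    simp [this]
  obtain ⟨Hc, hHc⟩ : ∃ Hc : Cyl → ℤ, ∀ p, Hc (covProj p) = H p :=
    ⟨fun z => H (Function.surjInv covProj_surjective z), fun p =>
      hper _ _ (Function.surjInv_eq covProj_surjective _)⟩
  have hcont : ContinuousOn Hc C := by
    intro z hz
    obtain ⟨p, rfl⟩ := covProj_surjective z
    refine (continuousWithinAt_const (b := Hc (covProj p))).congr_of_eventuallyEq ?_ rfl
    rw [EventuallyEq, eventually_nhdsWithin_iff, nhds_covProj, eventually_map]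
    filter_upwards [h p] with q hq hqC
    rw [hHc, hHc]
    simp [hz, sgnI_zero (hK0 q hqC)] at hq
    omega
  obtain ⟨z0, hz0⟩ := hne
  refine ⟨Hc z0, fun p hp => ?_, ?_⟩
  · rw [← hHc]; exact hC.constant hcont hp hz0
  have hK : ∀ p, covProj p ∈ C → H p = Hc z0 := by
    intro p hp; rw [← hHc]; exact hC.constant hcont hp hz0
  obtain ⟨p0, rfl⟩ := covProj_surjective z0
  have hl : IsLocallyConstant (fun q => (H q = Hc (covProj p0) ∨ H q = Hc (covProj p0) + 1)) := by
    rw [IsLocallyConstant.iff_eventually_eq]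
    intro p
    filter_upwards [h p] with q hq
    by_cases hp : covProj p ∈ C
    · rw [if_pos (by exact hp), hK p hp] at hq
      have h1 : H q = Hc (covProj p0) ∨ H q = Hc (covProj p0) + 1 := by
        unfold sgnI at hq; split_ifs at hq <;> omega
      simp only [h1, hK p hp, true_or]
    · rw [if_neg (by exact hp)] at hq
      have : H q = H p := by omega
      rw [this]
  intro q
  have := hl.apply_eq_of_preconnectedSpace q p0
  rw [this]; left; exact hK _ hz0

lemma log_branch {S : Set (ℝ × ℝ)} (hS : IsPreconnected S) {Λ D b : ℝ × ℝ → ℂ} (hΛ : Continuous Λ)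
    (hD : ∀ p, Complex.exp (Λ p) = D p) (hb : ContinuousOn b S) (hbD : ∀ p ∈ S, Complex.exp (b p) = D p)
    {p q : ℝ × ℝ} (hp : p ∈ S) (hq : q ∈ S) : Λ p - b p = Λ q - b q := by
  have := Complex.isCoveringMap_exp.eqOn_of_comp_eqOn (g₁ := Λ) (g₂ := fun r => b r + (Λ q - b q)) hS
    hΛ.continuousOn (hb.add continuousOn_const) (by
      intro r hr
      apply Subtype.ext
      simp only [Function.comp_apply]
      rw [hD, Complex.exp_add, Complex.exp_sub, hbD r hr, hbD q hq, hD q, div_self, mul_one]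
      rw [← hD]; exact Complex.exp_ne_zero _) hq (by simp)
  have h2 := this hp
  simp only at h2
  rw [h2]; ring

lemma crossing {L β : ℝ → ℝ × ℝ} (hL : Continuous L) (hβ : Continuous β) {w : ℤ} (hw : w ≠ 0)
    (hLw : ∀ t, L (t + 1) = L t + ((w : ℝ), 0)) (hLs : ∀ t, 0 < (L t).2 ∧ (L t).2 < 1)
    (h0 : (β 0).2 ≤ 0) (h1 : 1 ≤ (β 1).2) : ∃ s t, L s = β t := by
  by_contra! hne
  have hLn : ∀ (n : ℤ), L n = L 0 + ((n * w : ℝ), 0) := by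
    intro n
    induction n using Int.induction_on with
    | zero => ext <;> simp
    | succ i ih => push_cast; push_cast at ih; rw [hLw, ih]; ext <;> simp; ring
    | pred i ih =>
      have := hLw ((-(i : ℤ) - 1 : ℤ) : ℝ)
      push_cast at this ih ⊢
      rw [sub_add_cancel, ih] at this
      rw [← sub_eq_iff_eq_add] at this
      rw [← this]; ext <;> simp; ring
  obtain ⟨B, hB⟩ : ∃ B : ℝ, ∀ t ∈ Icc (0 : ℝ) 1, |(β t).1| ≤ B := by
    obtain ⟨B, hB⟩ := (isCompact_Icc (a := (0:ℝ)) (b := 1)).exists_bound_of_continuousOn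
      (f := fun t => (β t).1) (by fun_prop)
    exact ⟨B, hB⟩
  obtain ⟨m, hm⟩ := exists_nat_gt (B + |(L 0).1|)
  have hw2 : (1 : ℝ) ≤ (w : ℝ) * w := by
    have : (1 : ℤ) ≤ w * w := by
      rcases lt_or_gt_of_ne hw with h | h <;> nlinarith
    exact_mod_cast this
  have hm0 : (0 : ℝ) ≤ m := by positivity
  have hN1 := hLn (m * w)
  have hN0 := hLn (-(m * w))
  set N1 : ℝ := ((m * w : ℤ) : ℝ) with hN1d
  set N0 : ℝ := ((-(m * w) : ℤ) : ℝ) with hN0d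
  have hx1 : B < (L N1).1 := by
    rw [hN1]; simp [hN1d]
    have := neg_abs_le (L 0).1
    nlinarith
  have hx0 : (L N0).1 < -B := by
    rw [hN0]; simp [hN0d]
    have := le_abs_self (L 0).1
    nlinarith
  let D : ℝ × ℝ → ℂ := fun p => ⟨(L p.1).1 - (β p.2).1, (L p.1).2 - (β p.2).2⟩
  have hDre : ∀ p, (D p).re = (L p.1).1 - (β p.2).1 := fun p => rfl
  have hDim : ∀ p, (D p).im = (L p.1).2 - (β p.2).2 := fun p => rfl
  have hDc : Continuous D := by
    have : D = fun p => (((L p.1).1 - (β p.2).1 : ℝ) : ℂ) + (((L p.1).2 - (β p.2).2 : ℝ) : ℂ) * Complex.I := by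
      ext p; exact (Complex.re_add_im (D p)).symm
    rw [this]; fun_prop
  have hD0 : ∀ p, D p ≠ 0 := by
    intro p hp
    apply hne p.1 p.2
    rw [Complex.ext_iff] at hp
    simp only [hDre, hDim, Complex.zero_re, Complex.zero_im] at hp
    ext
    · linarith [hp.1]
    · linarith [hp.2]
  obtain ⟨Λ, hΛ, hΛD⟩ := lift_log D hDc hD0
  have slit : ∀ S : Set (ℝ × ℝ), (∀ p ∈ S, D p ∈ Complex.slitPlane) →
      ContinuousOn (fun p => Complex.log (D p)) S ∧ ∀ p ∈ S, Complex.exp (Complex.log (D p)) = D p := by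
    intro S hS
    exact ⟨hDc.continuousOn.clog hS, fun p _ => Complex.exp_log (hD0 p)⟩
  have im0 : ∀ s, 0 < (D (s, 0)).im := fun s => by rw [hDim]; have := hLs s; simp; linarith
  have im1 : ∀ s, (D (s, 1)).im < 0 := fun s => by rw [hDim]; have := hLs s; simp; linarith
  have re1 : ∀ t ∈ Icc (0 : ℝ) 1, 0 < (D (N1, t)).re := fun t ht => by
    rw [hDre]; have := (abs_le.1 (hB t ht)).2; simp; linarith
  have re0 : ∀ t ∈ Icc (0 : ℝ) 1, (D (N0, t)).re < 0 := fun t ht => by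
    rw [hDre]; have := (abs_le.1 (hB t ht)).1; simp; linarith
  -- bottom
  have e1 : Λ (N0, 0) - Complex.log (D (N0, 0)) = Λ (N1, 0) - Complex.log (D (N1, 0)) := by
    obtain ⟨h1, h2⟩ := slit (univ ×ˢ {0}) (by
      rintro ⟨s, t⟩ ⟨-, ht⟩; simp at ht; subst ht
      exact Or.inr (im0 s).ne')
    exact log_branch (isPreconnected_univ.prod isPreconnected_singleton) hΛ hΛD h1 h2 (by simp) (by simp)
  have e2 : Λ (N0, 1) - Complex.log (D (N0, 1)) = Λ (N1, 1) - Complex.log (D (N1, 1)) := by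
    obtain ⟨h1, h2⟩ := slit (univ ×ˢ {1}) (by
      rintro ⟨s, t⟩ ⟨-, ht⟩; simp at ht; subst ht
      exact Or.inr (im1 s).ne)
    exact log_branch (isPreconnected_univ.prod isPreconnected_singleton) hΛ hΛD h1 h2 (by simp) (by simp)
  have e3 : Λ (N1, 0) - Complex.log (D (N1, 0)) = Λ (N1, 1) - Complex.log (D (N1, 1)) := by
    obtain ⟨h1, h2⟩ := slit ({N1} ×ˢ Icc 0 1) (by
      rintro ⟨s, t⟩ ⟨hs, ht⟩; simp only [mem_singleton_iff] at hs; subst hs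
      exact Or.inl (re1 t ht))
    exact log_branch (isPreconnected_singleton.prod isPreconnected_Icc) hΛ hΛD h1 h2 (by simp) (by simp)
  have e4 : Λ (N0, 0) - (Complex.log (-D (N0, 0)) + Real.pi * Complex.I)
      = Λ (N0, 1) - (Complex.log (-D (N0, 1)) + Real.pi * Complex.I) := by
    refine log_branch (S := {N0} ×ˢ Icc 0 1) (b := fun p => Complex.log (-D p) + Real.pi * Complex.I)
      (isPreconnected_singleton.prod isPreconnected_Icc) hΛ hΛD ?_ ?_ (by simp) (by simp)
    · refine ContinuousOn.add (hDc.neg.continuousOn.clog ?_) continuousOn_const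
      rintro ⟨s, t⟩ ⟨hs, ht⟩; simp only [mem_singleton_iff] at hs; subst hs
      refine Or.inl ?_
      have := re0 t ht
      show 0 < (-D (N0, t)).re; rw [Complex.neg_re]; linarith
    · intro p hp
      rw [Complex.exp_add, Complex.exp_log (neg_ne_zero.2 (hD0 p)), Complex.exp_pi_mul_I]; ring
  have l0 : Complex.log (-D (N0, 0)) = Complex.log (D (N0, 0)) - Real.pi * Complex.I := by
    simp only [Complex.log, Complex.arg_neg_eq_arg_sub_pi_of_im_pos (im0 N0), norm_neg]
    push_cast; ring
  have l1 : Complex.log (-D (N0, 1)) = Complex.log (D (N0, 1)) + Real.pi * Complex.I := by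
    simp only [Complex.log, Complex.arg_neg_eq_arg_add_pi_of_im_neg (im1 N0), norm_neg]
    push_cast; ring
  rw [l0, l1] at e4
  have : (2 * Real.pi * Complex.I : ℂ) = 0 := by linear_combination e4 - e1 + e2 - e3
  simp [Real.pi_ne_zero] at this



lemma nullhomotopic_of_lift (γ : C(AddCircle (1 : ℝ), ↥annA)) (ξ : AddCircle (1 : ℝ) → ℝ)
    (hξ : Continuous ξ) (h : ∀ t, ((ξ t : ℝ) : AddCircle (1 : ℝ)) = (γ t : Cyl).1) :
    γ.Nullhomotopic := by
  let j : C(ℝ × ℝ, ↥annA) := ⟨fun p => ⟨((p.1 : AddCircle (1 : ℝ)), (projIcc (0 : ℝ) 1 zero_le_one p.2 : ℝ)),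
    ⟨mem_univ _, (projIcc (0 : ℝ) 1 zero_le_one p.2).2⟩⟩, by
      have : Continuous ((↑) : ℝ → AddCircle (1 : ℝ)) := AddCircle.continuous_mk' 1
      fun_prop⟩
  let k : C(AddCircle (1 : ℝ), ℝ × ℝ) := ⟨fun t => (ξ t, (γ t : Cyl).2), by fun_prop⟩
  have e : γ = j.comp ((ContinuousMap.id (ℝ × ℝ)).comp k) := by
    ext t
    · simp [j, k, h]
    · have : (γ t : Cyl).2 ∈ Icc (0 : ℝ) 1 := (γ t).2.2
      simp [j, k, projIcc_of_mem _ this]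
  rw [e]
  exact ((id_nullhomotopic (ℝ × ℝ)).comp_left k).comp_right j

lemma int_const {X : Type*} [TopologicalSpace X] [PreconnectedSpace X] {f : X → ℝ}
    (hf : Continuous f) (h : ∀ x y, ((f x : ℝ) : AddCircle (1 : ℝ)) = f y) (x y : X) : f x = f y :=
  (AddCircle.isCoveringMap_coe (1 : ℝ)).constOn_of_comp isPreconnected_univ hf.continuousOn
    (fun a _ b _ => h a b) (mem_univ x) (mem_univ y)

lemma coe_add_one (t : ℝ) : ((t + 1 : ℝ) : AddCircle (1 : ℝ)) = t := AddCircle.coe_add_period 1 t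

lemma descend {ℓ : ℝ → ℝ} (hℓ : Continuous ℓ) (hp : ∀ t, ℓ (t + 1) = ℓ t) :
    ∃ ξ : AddCircle (1 : ℝ) → ℝ, Continuous ξ ∧ ∀ t : ℝ, ξ t = ℓ t := by
  have hper : Function.Periodic ℓ 1 := hp
  refine ⟨hper.lift, ?_, fun t => Function.Periodic.lift_coe hper t⟩
  exact hℓ.quotient_lift _

lemma lift_of_nullhomotopic (γ : C(AddCircle (1 : ℝ), ↥annA)) (hγ : γ.Nullhomotopic) :
    ∃ ξ : AddCircle (1 : ℝ) → ℝ, Continuous ξ ∧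
      ∀ t, ((ξ t : ℝ) : AddCircle (1 : ℝ)) = (γ t : Cyl).1 := by
  obtain ⟨a, ⟨F⟩⟩ := hγ
  have hcoe : Continuous ((↑) : ℝ → AddCircle (1 : ℝ)) := AddCircle.continuous_mk' 1
  obtain ⟨L, hL, hLf⟩ := lift_circle (X := ℝ × ℝ)
    (fun p => (F (projIcc (0 : ℝ) 1 zero_le_one p.1, (p.2 : AddCircle (1 : ℝ))) : Cyl).1) (by fun_prop)
  have h1 : ∀ t, L (1, t + 1) = L (1, t) := by
    intro t
    refine int_const (f := fun t => L (1, t)) (by fun_prop) ?_ _ _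
    intro x y
    rw [hLf, hLf]; simp
  have h2 : ∀ p : ℝ × ℝ, L (p.1, p.2 + 1) - L p = L (1, 0 + 1) - L (1, 0) := by
    intro p
    refine int_const (f := fun p : ℝ × ℝ => L (p.1, p.2 + 1) - L p) (by fun_prop) ?_ p (1, 0)
    intro x y
    rw [AddCircle.coe_sub, AddCircle.coe_sub, hLf, hLf, hLf, hLf]; simp
  obtain ⟨ξ, hξ, hξL⟩ := descend (ℓ := fun t => L (0, t)) (by fun_prop) (by
    intro t
    have := h2 (0, t)
    rw [h1 0] at this
    simpa [sub_eq_zero] using this)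
  refine ⟨ξ, hξ, fun t => ?_⟩
  obtain ⟨x, rfl⟩ := QuotientAddGroup.mk_surjective t
  have := hξL x
  change ((ξ (x : AddCircle (1:ℝ)) : ℝ) : AddCircle (1 : ℝ)) = _
  rw [this, hLf]
  simp

/-- lift of a loop to the plane -/
lemma loop_lift (γ : C(AddCircle (1 : ℝ), ↥annA)) : ∃ (L : ℝ → ℝ × ℝ) (w : ℤ), Continuous L ∧
    (∀ t : ℝ, covProj (L t) = γ t) ∧ (∀ t, L (t + 1) = L t + ((w : ℝ), 0)) := by
  have hcoe : Continuous ((↑) : ℝ → AddCircle (1 : ℝ)) := AddCircle.continuous_mk' 1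
  obtain ⟨ℓ, hℓ, hℓf⟩ := lift_circle (X := ℝ) (fun t => (γ (t : AddCircle (1 : ℝ)) : Cyl).1) (by fun_prop)
  have h2 : ∀ t, ℓ (t + 1) - ℓ t = ℓ (0 + 1) - ℓ 0 := by
    intro p
    refine int_const (f := fun p => ℓ (p + 1) - ℓ p) (by fun_prop) ?_ p 0
    intro x y
    rw [AddCircle.coe_sub, AddCircle.coe_sub, hℓf, hℓf, hℓf, hℓf]; simp
  obtain ⟨w, hw⟩ : ∃ w : ℤ, ℓ (0 + 1) = ℓ 0 + w := by
    rw [← coe_circle_eq_iff, hℓf, hℓf, coe_add_one]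
  refine ⟨fun t => (ℓ t, (γ (t : AddCircle (1 : ℝ)) : Cyl).2), w, by fun_prop, fun t => ?_, fun t => ?_⟩
  · simp [covProj, hℓf]
  · ext
    · have := h2 t
      simp; linarith
    · simp

lemma null_jump {g : ℝ × ℝ → ℝ} (hg : Good g) {C : Set Cyl} (hCZ : C ⊆ ZC g)
    (hZK : IsClosed ({p | g p = 0} \ covProj ⁻¹' C))
    (γ : C(AddCircle (1 : ℝ), ↥annA)) (hγC : (Set.range fun t => ((γ t : Cyl))) = C)
    (hinj : Function.Injective γ) (hγ : γ.Nullhomotopic) {H : ℝ × ℝ → ℤ}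
    (h : Jump g (covProj ⁻¹' C) H) : H (0, 1) = H (0, 0) := by
  obtain ⟨ξ, hξ, hξγ⟩ := lift_of_nullhomotopic γ hγ
  obtain ⟨B, hB⟩ : ∃ B : ℝ, ∀ t, |ξ t| ≤ B := by
    obtain ⟨B, hB⟩ := (isCompact_univ (X := AddCircle (1 : ℝ))).exists_bound_of_continuousOn
      hξ.continuousOn
    exact ⟨B, fun t => hB t (mem_univ t)⟩
  obtain ⟨M, hM⟩ := exists_nat_gt B
  have hcp := covProj_continuous
  have hK0 : ∀ p, covProj p ∈ C → g p = 0 := fun p hp => (hg.mem_ZC p).1 (hCZ hp)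
  let Q : Set (ℝ × ℝ) := {p | ∃ t, covProj p = γ t ∧ |p.1 - ξ t| ≤ M}
  let Q' : Set (ℝ × ℝ) := {p | ∃ t, covProj p = γ t ∧ M + 1 ≤ |p.1 - ξ t|}
  have hQ : IsClosed Q := by
    have : Q = Prod.fst '' {r : (ℝ × ℝ) × AddCircle (1 : ℝ) | covProj r.1 = γ r.2 ∧ |r.1.1 - ξ r.2| ≤ M} := by
      ext p; simp [Q]
    rw [this]
    apply isClosedMap_fst_of_compactSpace
    have h1 : IsClosed {r : (ℝ × ℝ) × AddCircle (1 : ℝ) | covProj r.1 = γ r.2} :=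
      isClosed_eq (by fun_prop) (by fun_prop)
    have h2 : IsClosed {r : (ℝ × ℝ) × AddCircle (1 : ℝ) | |r.1.1 - ξ r.2| ≤ M} :=
      isClosed_le (by fun_prop) (by fun_prop)
    exact h1.inter h2
  have hQ' : IsClosed Q' := by
    have : Q' = Prod.fst '' {r : (ℝ × ℝ) × AddCircle (1 : ℝ) | covProj r.1 = γ r.2 ∧ M + 1 ≤ |r.1.1 - ξ r.2|} := by
      ext p; simp [Q']
    rw [this]
    apply isClosedMap_fst_of_compactSpace
    have h1 : IsClosed {r : (ℝ × ℝ) × AddCircle (1 : ℝ) | covProj r.1 = γ r.2} :=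
      isClosed_eq (by fun_prop) (by fun_prop)
    have h2 : IsClosed {r : (ℝ × ℝ) × AddCircle (1 : ℝ) | M + 1 ≤ |r.1.1 - ξ r.2|} :=
      isClosed_le (by fun_prop) (by fun_prop)
    exact h1.inter h2
  have hQC : Q ⊆ covProj ⁻¹' C := by
    rintro p ⟨t, ht, -⟩; rw [← hγC]; exact ⟨t, ht.symm⟩
  have hQC' : Q' ⊆ covProj ⁻¹' C := by
    rintro p ⟨t, ht, -⟩; rw [← hγC]; exact ⟨t, ht.symm⟩
  have hd : Disjoint Q Q' := by
    rw [Set.disjoint_left]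
    rintro p ⟨t, ht, h1⟩ ⟨t', ht', h2⟩
    have : t = t' := hinj (Subtype.ext (ht.symm.trans ht'))
    subst this; linarith
  have hU : Q ∪ Q' = covProj ⁻¹' C := by
    refine (union_subset hQC hQC').antisymm ?_
    intro p hp
    have hp' : covProj p ∈ C := hp
    rw [← hγC] at hp'
    obtain ⟨t, ht⟩ := hp'
    have ht : (γ t : Cyl) = covProj p := ht
    have : ((ξ t : ℝ) : AddCircle (1 : ℝ)) = (p.1 : ℝ) := by rw [hξγ, ht]; rfl
    obtain ⟨n, hn⟩ := (coe_circle_eq_iff _ _).1 this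
    have hn' : p.1 - ξ t = n := by linarith
    by_cases hnM : |n| ≤ M
    · left; refine ⟨t, ht.symm, ?_⟩
      rw [hn']; exact_mod_cast hnM
    · right; refine ⟨t, ht.symm, ?_⟩
      rw [hn']
      have : (M : ℤ) + 1 ≤ |n| := by omega
      exact_mod_cast this
  have hZQ : {p | g p = 0} \ Q = ({p | g p = 0} \ covProj ⁻¹' C) ∪ Q' := by
    ext p
    have hQp : p ∈ covProj ⁻¹' C ↔ p ∈ Q ∨ p ∈ Q' := by rw [← hU]; rfl
    have hdp : p ∈ Q → p ∉ Q' := fun h => Set.disjoint_left.1 hd h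
    have h0 : p ∈ Q' → g p = 0 := fun h => hK0 p (hQC' h)
    simp only [Set.mem_sdiff, mem_union, hQp, mem_ofPred_eq]
    tauto
  have hZQ' : {p | g p = 0} \ Q' = ({p | g p = 0} \ covProj ⁻¹' C) ∪ Q := by
    ext p
    have hQp : p ∈ covProj ⁻¹' C ↔ p ∈ Q ∨ p ∈ Q' := by rw [← hU]; rfl
    have hdp : p ∈ Q → p ∉ Q' := fun h => Set.disjoint_left.1 hd h
    have h0 : p ∈ Q → g p = 0 := fun h => hK0 p (hQC h)
    simp only [Set.mem_sdiff, mem_union, hQp, mem_ofPred_eq]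
    tauto
  obtain ⟨H1, hH1⟩ := exists_jump hg.cont hQ (fun p hp => hK0 p (hQC hp))
    (by rw [hZQ]; exact hZK.union hQ')
  obtain ⟨H2, hH2⟩ := exists_jump hg.cont hQ' (fun p hp => hK0 p (hQC' hp))
    (by rw [hZQ']; exact hZK.union hQ)
  have hs := hH1.add hH2 hd
  rw [hU] at hs
  have e := h.sub_const hs (0, 1) (0, 0)
  have e1 : H1 (0, 1) = H1 (0, 0) := by
    refine hH1.miss (fun p hp => hg.strip (hK0 p (hQC hp))) (B + M + 1) ?_
    rintro p ⟨t, ht, h1⟩ hx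
    have := abs_le.1 (hB t)
    have := abs_le.1 h1
    linarith
  have e2 : H2 (0, 1) = H2 (0, 0) := by
    refine hH2.miss (fun p hp => hg.strip (hK0 p (hQC' hp))) 0 ?_
    rintro p ⟨t, ht, h1⟩ hx
    have := hB t
    rw [hx, zero_sub, abs_neg] at h1
    linarith
  omega



lemma preconnected_of_collar {X : Type*} [TopologicalSpace X] [PreconnectedSpace X] {C D : Set X}
    (hC : IsPreconnected C) (hD : IsOpen D)
    (hcl : closure D ⊆ D ∪ C) (hcd : C ⊆ closure D)
    (hloc : ∀ z ∈ C, ∃ U ∈ 𝓝 z, ∃ B ⊆ D, IsPreconnected B ∧ U ∩ D ⊆ B) : IsPreconnected D := by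
  -- a piece whose closure misses C is clopen
  have key : ∀ u v : Set X, IsOpen u → IsOpen v → D ⊆ u ∪ v → (D ∩ u).Nonempty → (D ∩ v).Nonempty →
      ¬ (D ∩ (u ∩ v)).Nonempty → (C ∩ closure (D ∩ u)).Nonempty := by
    intro u v hu hv huv hDu hDv hn
    by_contra hemp
    have hclosed : IsClosed (D ∩ u) := by
      rw [← closure_subset_iff_isClosed]
      intro z hz
      have hzC : z ∉ C := fun h => hemp ⟨z, h, hz⟩
      have hzD : z ∈ D := (hcl (closure_mono inter_subset_left hz)).resolve_right hzC
      refine ⟨hzD, ?_⟩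
      by_contra hzu
      have hzv : z ∈ v := (huv hzD).resolve_left hzu
      obtain ⟨y, hyv, hyD, hyu⟩ := mem_closure_iff.1 hz v hv hzv
      exact hn ⟨y, hyD, hyu, hyv⟩
    have := IsClopen.eq_univ ⟨hclosed, hD.inter hu⟩ hDu
    obtain ⟨y, hyD, hyv⟩ := hDv
    have hy : y ∈ D ∩ u := this ▸ mem_univ y
    exact hn ⟨y, hyD, hy.2, hyv⟩
  intro u v hu hv huv hDu hDv
  by_contra hn
  have h1 := key u v hu hv huv hDu hDv hn
  have h2 := key v u hv hu (by rwa [union_comm]) hDv hDu (by rwa [inter_comm v u])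
  have := isPreconnected_closed_iff.1 hC _ _ (isClosed_closure (s := D ∩ u))
    (isClosed_closure (s := D ∩ v)) (by
      rw [← closure_union, ← inter_union_distrib_left, inter_eq_left.2 huv]; exact hcd) h1 h2
  obtain ⟨z, hzC, hzu, hzv⟩ := this
  obtain ⟨U, hU, B, hBD, hB, hUB⟩ := hloc z hzC
  obtain ⟨a, haU, ha⟩ := mem_closure_iff_nhds.1 hzu U hU
  obtain ⟨b, hbU, hb⟩ := mem_closure_iff_nhds.1 hzv U hU
  obtain ⟨y, hyB, hy⟩ := hB u v hu hv (hBD.trans huv) ⟨a, hUB ⟨haU, ha.1⟩, ha.2⟩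
    ⟨b, hUB ⟨hbU, hb.1⟩, hb.2⟩
  exact hn ⟨y, hBD hyB, hy⟩

def tau (g : ℝ × ℝ → ℝ) (p : ℝ × ℝ) : ℝ × ℝ := (fderiv ℝ g p (0, 1), -fderiv ℝ g p (1, 0))

def dotp (u v : ℝ × ℝ) : ℝ := u.1 * v.1 + u.2 * v.2

lemma fderiv_apply_eq (g : ℝ × ℝ → ℝ) (p v : ℝ × ℝ) :
    fderiv ℝ g p v = v.1 * fderiv ℝ g p (1, 0) + v.2 * fderiv ℝ g p (0, 1) := by
  have : v = v.1 • ((1 : ℝ), (0 : ℝ)) + v.2 • ((0 : ℝ), (1 : ℝ)) := by ext <;> simp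
  conv_lhs => rw [this, map_add, map_smul, map_smul]
  simp

lemma tau_pos {g : ℝ × ℝ → ℝ} {p : ℝ × ℝ} (h : fderiv ℝ g p ≠ 0) :
    0 < dotp (tau g p) (tau g p) := by
  by_contra hn
  apply h
  simp only [dotp, tau] at hn
  have h1 : fderiv ℝ g p (0, 1) = 0 := by nlinarith [sq_nonneg (fderiv ℝ g p (0, 1)), sq_nonneg (fderiv ℝ g p (1, 0))]
  have h2 : fderiv ℝ g p (1, 0) = 0 := by nlinarith [sq_nonneg (fderiv ℝ g p (0, 1)), sq_nonneg (fderiv ℝ g p (1, 0))]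
  refine ContinuousLinearMap.ext fun v => ?_
  rw [fderiv_apply_eq, h1, h2]; simp

lemma chart {g : ℝ × ℝ → ℝ} (hg : Good g) {p : ℝ × ℝ} (hp : g p = 0) {W : Set (ℝ × ℝ)}
    (hW : W ∈ 𝓝 p) : ∃ r > 0, ∃ σ : ℝ × ℝ → ℝ × ℝ, ∃ U ∈ 𝓝 p, U ⊆ W ∧
      ContinuousOn σ (Metric.ball 0 r) ∧ MapsTo σ (Metric.ball 0 r) U ∧
      (∀ v ∈ Metric.ball (0 : ℝ × ℝ) r, (dotp (tau g p) (σ v - p), g (σ v)) = v) ∧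
      ∀ q ∈ U, (dotp (tau g p) (q - p), g q) ∈ Metric.ball (0 : ℝ × ℝ) r ∧
        σ (dotp (tau g p) (q - p), g q) = q := by
  have hn := tau_pos (hg.reg p hp)
  obtain ⟨a, ha⟩ : ∃ a, a = fderiv ℝ g p (1, 0) := ⟨_, rfl⟩
  obtain ⟨b, hb⟩ : ∃ b, b = fderiv ℝ g p (0, 1) := ⟨_, rfl⟩
  simp only [dotp, tau, ← ha, ← hb] at hn ⊢
  have hn' : a ^ 2 + b ^ 2 ≠ 0 := by nlinarith
  let A1 : ℝ × ℝ →L[ℝ] ℝ × ℝ :=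
    (b • ContinuousLinearMap.fst ℝ ℝ ℝ + (-a) • ContinuousLinearMap.snd ℝ ℝ ℝ).prod
      (a • ContinuousLinearMap.fst ℝ ℝ ℝ + b • ContinuousLinearMap.snd ℝ ℝ ℝ)
  let A2 : ℝ × ℝ →L[ℝ] ℝ × ℝ :=
    ((b / (a ^ 2 + b ^ 2)) • ContinuousLinearMap.fst ℝ ℝ ℝ + (a / (a ^ 2 + b ^ 2)) • ContinuousLinearMap.snd ℝ ℝ ℝ).prod
      ((-a / (a ^ 2 + b ^ 2)) • ContinuousLinearMap.fst ℝ ℝ ℝ + (b / (a ^ 2 + b ^ 2)) • ContinuousLinearMap.snd ℝ ℝ ℝ)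
  let A : (ℝ × ℝ) ≃L[ℝ] ℝ × ℝ := ContinuousLinearEquiv.equivOfInverse A1 A2
    (by intro x; ext <;> simp [A1, A2] <;> field_simp <;> ring)
    (by intro x; ext <;> simp [A1, A2] <;> field_simp <;> ring)
  let Φ : ℝ × ℝ → ℝ × ℝ := fun q => (b * (q - p).1 + -a * (q - p).2, g q)
  have hgp := (hg.smooth p hp).differentiableAt (by norm_num)
  have hΦ1 : ContDiffAt ℝ 1 Φ p := by
    refine ContDiffAt.prodMk ?_ (hg.smooth p hp)
    have : (fun q : ℝ × ℝ => b * (q - p).1 + -a * (q - p).2) = fun q : ℝ × ℝ => b * (q.1 - p.1) + -a * (q.2 - p.2) := rfl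
    rw [this]; fun_prop
  have hΦ2 : HasFDerivAt Φ (A : ℝ × ℝ →L[ℝ] ℝ × ℝ) p := by
    have e : (A : ℝ × ℝ →L[ℝ] ℝ × ℝ) = (b • ContinuousLinearMap.fst ℝ ℝ ℝ + (-a) • ContinuousLinearMap.snd ℝ ℝ ℝ).prod (fderiv ℝ g p) := by
      refine ContinuousLinearMap.ext fun v => ?_
      have := fderiv_apply_eq g p v
      rw [← ha, ← hb] at this
      ext
      · rfl
      · change a * v.1 + b * v.2 = fderiv ℝ g p v
        rw [this]; ring
    rw [e]
    refine HasFDerivAt.prodMk ?_ hgp.hasFDerivAt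
    set B : ℝ × ℝ →L[ℝ] ℝ := b • ContinuousLinearMap.fst ℝ ℝ ℝ + (-a) • ContinuousLinearMap.snd ℝ ℝ ℝ
    have h1 : HasFDerivAt (fun q : ℝ × ℝ => B q - B p) B p := B.hasFDerivAt.sub_const _
    convert! h1 using 1
    ext q
    rw [← map_sub]; rfl
  let e := hΦ1.toOpenPartialHomeomorph Φ hΦ2 one_ne_zero
  have hes : p ∈ e.source := hΦ1.mem_toOpenPartialHomeomorph_source hΦ2 one_ne_zero
  have hec : ∀ q, e q = Φ q := fun q => rfl
  have hp0 : e p = 0 := by rw [hec]; simp [Φ, hp]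
  have het : (0 : ℝ × ℝ) ∈ e.target := hp0 ▸ e.map_source hes
  have hsymm : e.symm 0 = p := by rw [← hp0, e.left_inv hes]
  have hnb : e.target ∩ e.symm ⁻¹' W ∈ 𝓝 (0 : ℝ × ℝ) := by
    refine inter_mem (e.open_target.mem_nhds het) ?_
    exact (e.continuousAt_symm het).preimage_mem_nhds (by rwa [hsymm])
  obtain ⟨r, hr, hball⟩ := Metric.mem_nhds_iff.1 hnb
  have hbt : Metric.ball (0 : ℝ × ℝ) r ⊆ e.target := fun v hv => (hball hv).1
  refine ⟨r, hr, e.symm, e.source ∩ e ⁻¹' (Metric.ball 0 r), ?_, ?_, ?_, ?_, ?_, ?_⟩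
  · refine inter_mem (e.open_source.mem_nhds hes) ?_
    exact (e.continuousAt hes).preimage_mem_nhds (by rw [hp0]; exact Metric.ball_mem_nhds _ hr)
  · rintro q ⟨hq, hq'⟩
    have := (hball hq').2
    rwa [mem_preimage, e.left_inv hq] at this
  · exact e.continuousOn_symm.mono hbt
  · intro v hv
    refine ⟨e.map_target (hbt hv), ?_⟩
    rw [mem_preimage, e.right_inv (hbt hv)]; exact hv
  · intro v hv
    exact e.right_inv (hbt hv)
  · rintro q ⟨hq, hq'⟩
    exact ⟨hq', e.left_inv hq⟩

lemma sides {g : ℝ × ℝ → ℝ} (hg : Good g) {p : ℝ × ℝ} (hp : g p = 0) {W : Set (ℝ × ℝ)}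
    (hW : W ∈ 𝓝 p) : ∃ U ∈ 𝓝 p, U ⊆ W ∧ IsConnected (U ∩ {q | g q < 0}) ∧
      IsConnected (U ∩ {q | 0 < g q}) := by
  obtain ⟨r, hr, σ, U, hU, hUW, hσ, hσU, hσ1, hσ2⟩ := chart hg hp hW
  have hmem : ∀ y : ℝ, |y| < r → ((0 : ℝ), y) ∈ Metric.ball (0 : ℝ × ℝ) r := by
    intro y hy; simp [Prod.norm_def, hy]
  refine ⟨U, hU, hUW, ?_, ?_⟩
  · have : U ∩ {q | g q < 0} = σ '' (Metric.ball 0 r ∩ {v | v.2 < 0}) := by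
      ext q; constructor
      · rintro ⟨h1, h2⟩
        exact ⟨_, ⟨(hσ2 q h1).1, h2⟩, (hσ2 q h1).2⟩
      · rintro ⟨v, ⟨h1, h2⟩, rfl⟩
        refine ⟨hσU h1, ?_⟩
        have := congrArg Prod.snd (hσ1 v h1)
        change g (σ v) < 0
        change g (σ v) = v.2 at this
        rw [this]; exact h2
    rw [this]
    have hr2 : |-(r/2)| < r := by rw [abs_neg, abs_of_pos] <;> linarith
    refine IsConnected.image (s := Metric.ball (0 : ℝ × ℝ) r ∩ {v | v.2 < 0}) ⟨⟨(0, -(r/2)), hmem _ hr2, ?_⟩, ?_⟩ _ (hσ.mono inter_subset_left)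
    · change -(r/2) < 0; linarith
    · exact ((convex_ball 0 r).inter (convex_halfSpace_lt (IsLinearMap.mk (fun _ _ => rfl) (fun _ _ => rfl)) 0)).isPreconnected
  · have : U ∩ {q | 0 < g q} = σ '' (Metric.ball 0 r ∩ {v | 0 < v.2}) := by
      ext q; constructor
      · rintro ⟨h1, h2⟩
        exact ⟨_, ⟨(hσ2 q h1).1, h2⟩, (hσ2 q h1).2⟩
      · rintro ⟨v, ⟨h1, h2⟩, rfl⟩
        refine ⟨hσU h1, ?_⟩
        have := congrArg Prod.snd (hσ1 v h1)
        change 0 < g (σ v)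
        change g (σ v) = v.2 at this
        rw [this]; exact h2
    rw [this]
    have hr2 : |r/2| < r := by rw [abs_of_pos] <;> linarith
    refine IsConnected.image (s := Metric.ball (0 : ℝ × ℝ) r ∩ {v | 0 < v.2}) ⟨⟨(0, (r/2)), hmem _ hr2, ?_⟩, ?_⟩ _ (hσ.mono inter_subset_left)
    · change 0 < (r/2); linarith
    · exact ((convex_ball 0 r).inter (convex_halfSpace_gt (IsLinearMap.mk (fun _ _ => rfl) (fun _ _ => rfl)) 0)).isPreconnected

lemma Jump.per {g : ℝ × ℝ → ℝ} (hg : Good g) {C : Set Cyl} 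
    (hCZ : C ⊆ ZC g) {H : ℝ × ℝ → ℤ} (h : Jump g (covProj ⁻¹' C) H) :
    ∀ p q, covProj p = covProj q → H p = H q := by
  have hK0 : ∀ p, covProj p ∈ C → g p = 0 := fun p hp => (hg.mem_ZC p).1 (hCZ hp)
  intro p q hpq
  obtain ⟨n, rfl⟩ := (covProj_eq_iff _ _).1 hpq
  symm
  apply h.periodic (fun p hp => hg.strip (hK0 p hp)) n (hg.perZ n)
  intro p
  have : covProj (p + ((n : ℝ), 0)) = covProj p := ((covProj_eq_iff _ _).2 ⟨n, rfl⟩).symm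
  simp [this]

lemma jump_ne {g : ℝ × ℝ → ℝ} (hg : Good g) {C : Set Cyl} (hC : IsConnected C)
    (hCc : IsClosed C) (hCZ : C ⊆ ZC g)
    (hZK : IsClosed ({p | g p = 0} \ covProj ⁻¹' C)) {H : ℝ × ℝ → ℤ}
    (h : Jump g (covProj ⁻¹' C) H) {L : ℝ → ℝ × ℝ} (hL : Continuous L) {w : ℤ} (hw : w ≠ 0)
    (hLw : ∀ t, L (t + 1) = L t + ((w : ℝ), 0)) (hLC : ∀ t, covProj (L t) ∈ C) :
    H (0, 1) ≠ H (0, 0) := by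
  intro heq
  have hK0 : ∀ p, covProj p ∈ C → g p = 0 := fun p hp => (hg.mem_ZC p).1 (hCZ hp)
  have hper := h.per hg hCZ
  obtain ⟨c, hc1, hc2⟩ := h.two hg hC.2 hCZ hC.1
  set k := H (0, 0) with hk
  have hKc : IsClosed (covProj ⁻¹' C) := hCc.preimage covProj_continuous
  let E : Set (ℝ × ℝ) := {q | covProj q ∉ C ∧ H q = k}
  have hEper : ∀ p q, covProj p = covProj q → q ∈ E → p ∈ E := by
    rintro p q hpq ⟨h1, h2⟩
    exact ⟨by rwa [hpq], by rw [hper p q hpq, h2]⟩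
  have hmemD : ∀ p, covProj p ∈ covProj '' E ↔ p ∈ E :=
    fun p => ⟨fun ⟨q, hq, e⟩ => hEper p q e.symm hq, fun hp => ⟨p, hp, rfl⟩⟩
  have hlc : ∀ p, covProj p ∉ C → ∀ᶠ q in 𝓝 p, H q = H p := by
    intro p hp
    filter_upwards [h p] with q hq
    rw [if_neg (show p ∉ covProj ⁻¹' C from hp)] at hq; omega
  have hEo : IsOpen E := by
    rw [isOpen_iff_mem_nhds]
    rintro p ⟨h1, h2⟩
    filter_upwards [hlc p h1, hKc.isOpen_compl.mem_nhds (show p ∈ (covProj ⁻¹' C)ᶜ from h1)] with q hq hq'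
    exact ⟨hq', by rw [hq, h2]⟩
  -- side sets
  obtain ⟨S, hS1, hS2⟩ : ∃ S : Set (ℝ × ℝ), (∀ q, g q ≠ 0 → (c + sgnI g q = k ↔ q ∈ S)) ∧
      ∀ p, g p = 0 → ∀ W ∈ 𝓝 p, ∃ U ∈ 𝓝 p, U ⊆ W ∧ IsConnected (U ∩ {q | g q ≠ 0 ∧ q ∈ S}) := by
    rcases hc2 (0, 0) with h0 | h0
    · refine ⟨{q | g q < 0}, fun q hq => ?_, fun p hp W hW => ?_⟩
      · rw [hk, h0, sgnI]
        constructor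
        · intro hh; change g q < 0
          by_contra hgq
          rw [if_pos (lt_of_le_of_ne (not_lt.1 hgq) hq.symm)] at hh; omega
        · intro hh
          have : g q < 0 := hh
          rw [if_neg (by linarith)]; simp
      · obtain ⟨U, hU, hUW, h1, -⟩ := sides hg hp hW
        refine ⟨U, hU, hUW, ?_⟩
        convert! h1 using 2
        ext q; simp only [mem_ofPred_eq]
        exact ⟨fun h => h.2, fun h => ⟨h.ne, h⟩⟩
    · refine ⟨{q | 0 < g q}, fun q hq => ?_, fun p hp W hW => ?_⟩
      · rw [hk, h0, sgnI]
        constructor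
        · intro hh; change 0 < g q
          by_contra hgq
          rw [if_neg hgq] at hh; omega
        · intro hh
          have : 0 < g q := hh
          rw [if_pos (by linarith)]
      · obtain ⟨U, hU, hUW, -, h1⟩ := sides hg hp hW
        refine ⟨U, hU, hUW, ?_⟩
        convert! h1 using 2
        ext q; simp only [mem_ofPred_eq]
        exact ⟨fun h => h.2, fun h => ⟨h.ne', h⟩⟩
  have hloc : ∀ p, covProj p ∈ C → ∀ W ∈ 𝓝 p, ∃ U ∈ 𝓝 p, U ⊆ W ∧ IsConnected (U ∩ E) := by
    intro p hp W hW
    have h1 : ({q | g q = 0} \ covProj ⁻¹' C)ᶜ ∈ 𝓝 p := hZK.isOpen_compl.mem_nhds (fun hh => hh.2 hp)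
    have h2 := h p
    obtain ⟨U, hU, hUW, hUc⟩ := hS2 p (hK0 p hp) _ (inter_mem hW (inter_mem h1 h2))
    refine ⟨U, hU, hUW.trans inter_subset_left, ?_⟩
    convert! hUc using 1
    ext q
    constructor
    · rintro ⟨hq, hq1, hq2⟩
      obtain ⟨-, hz, hj⟩ := hUW hq
      have hg0 : g q ≠ 0 := fun hh => hz ⟨hh, hq1⟩
      refine ⟨hq, hg0, (hS1 q hg0).1 ?_⟩
      have hj : H q - H p = _ := hj
      rw [if_pos (show p ∈ covProj ⁻¹' C from hp), hc1 p hp] at hj; omega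
    · rintro ⟨hq, hq1, hq2⟩
      obtain ⟨-, hz, hj⟩ := hUW hq
      refine ⟨hq, fun hh => hq1 (hK0 q hh), ?_⟩
      have hj : H q - H p = _ := hj
      have := (hS1 q hq1).2 hq2
      rw [if_pos (show p ∈ covProj ⁻¹' C from hp), hc1 p hp] at hj; omega
  have hDo : IsOpen (covProj '' E) := covProj_isOpenMap _ hEo
  have hDp : IsPreconnected (covProj '' E) := by
    refine preconnected_of_collar hC.2 hDo ?_ ?_ ?_
    · intro z hz
      obtain ⟨p, rfl⟩ := covProj_surjective z
      by_cases hpC : covProj p ∈ C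
      · exact Or.inr hpC
      · left
        have hnb : covProj '' {q | H q = H p} ∈ 𝓝 (covProj p) := by
          rw [nhds_covProj]; exact image_mem_map (hlc p hpC)
        obtain ⟨_, ⟨q, hq, rfl⟩, hq'⟩ := mem_closure_iff_nhds.1 hz _ hnb
        rw [hmemD] at hq' ⊢
        exact ⟨hpC, by rw [← hq'.2]; exact hq.symm⟩
    · intro z hz
      obtain ⟨p, rfl⟩ := covProj_surjective z
      rw [mem_closure_iff_nhds]
      intro N hN
      obtain ⟨U, hU, hUN, hUc⟩ := hloc p hz _ (covProj_continuous.continuousAt.preimage_mem_nhds hN)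
      obtain ⟨q, hq, hqE⟩ := hUc.1
      exact ⟨covProj q, hUN hq, q, hqE, rfl⟩
    · intro z hz
      obtain ⟨p, rfl⟩ := covProj_surjective z
      obtain ⟨U, hU, -, hUc⟩ := hloc p hz univ univ_mem
      refine ⟨covProj '' U, by rw [nhds_covProj]; exact image_mem_map hU, covProj '' (U ∩ E),
        image_mono inter_subset_right, hUc.2.image _ covProj_continuous.continuousOn, ?_⟩
      rintro _ ⟨⟨q, hq, rfl⟩, hq'⟩
      exact ⟨q, ⟨hq, (hmemD q).1 hq'⟩, rfl⟩
  have hm0 : ((0 : ℝ), (0 : ℝ)) ∈ E := ⟨fun hh => (hg.strip (hK0 _ hh)).1.ne' rfl, rfl⟩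
  have hm1 : ((0 : ℝ), (1 : ℝ)) ∈ E := ⟨fun hh => (hg.strip (hK0 _ hh)).2.ne rfl, heq⟩
  have hDc : IsConnected (covProj '' E) := ⟨⟨_, _, hm0, rfl⟩, hDp⟩
  haveI : LocallyPathConnectedSpace Cyl :=
    (covProj_isOpenMap.isQuotientMap covProj_continuous covProj_surjective).locallyPathConnectedSpace
  have hpc : IsPathConnected (covProj '' E) := hDo.isConnected_iff_isPathConnected.1 hDc
  obtain ⟨P, hP⟩ := hpc.joinedIn _ ⟨_, hm0, rfl⟩ _ ⟨_, hm1, rfl⟩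
  obtain ⟨ℓ, hℓ, hℓP⟩ := lift_circle (fun t : ℝ => (P.extend t).1) (by fun_prop)
  let β : ℝ → ℝ × ℝ := fun t => (ℓ t, (P.extend t).2)
  have hβP : ∀ t, covProj (β t) = P.extend t := fun t => Prod.ext (hℓP t) rfl
  have hPD : ∀ t, P.extend t ∈ covProj '' E := by
    intro t
    have : P.extend t ∈ range P := by rw [← Path.extend_range]; exact mem_range_self t
    obtain ⟨s, hs⟩ := this
    rw [← hs]; exact hP s
  obtain ⟨s, t, hst⟩ := crossing (β := β) hL (by fun_prop) hw hLw
    (fun t => hg.strip (hK0 _ (hLC t))) (by change (P.extend 0).2 ≤ 0; rw [Path.extend_zero]; exact le_refl _)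
    (by change 1 ≤ (P.extend 1).2; rw [Path.extend_one]; exact le_refl _)
  have h1 := hPD t
  rw [← hβP, hmemD, ← hst] at h1
  exact h1.1 (hLC s)



lemma tau_per {g : ℝ × ℝ → ℝ} (hg : Good g) (n : ℤ) (p : ℝ × ℝ) :
    tau g (p + ((n : ℝ), 0)) = tau g p := by
  have : fderiv ℝ g (p + ((n : ℝ), 0)) = fderiv ℝ g p := by
    rw [← fderiv_comp_add_right]
    congr 1
    ext q; exact hg.perZ n q
  simp [tau, this]

lemma dotp_sub (v p q : ℝ × ℝ) : dotp v (p - q) = dotp v p - dotp v q := by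
  simp [dotp]; ring

lemma dotp_continuous (v : ℝ × ℝ) : Continuous (dotp v) := by
  unfold dotp; fun_prop

lemma ZC_compact {g : ℝ × ℝ → ℝ} (hg : Good g) : IsCompact (ZC g) := by
  have h1 : IsCompact ((Icc (0:ℝ) 1 ×ˢ Icc (0:ℝ) 1) ∩ {p | g p = 0}) :=
    (isCompact_Icc.prod isCompact_Icc).inter_right (isClosed_eq hg.cont continuous_const)
  have : ZC g = covProj '' ((Icc (0:ℝ) 1 ×ˢ Icc (0:ℝ) 1) ∩ {p | g p = 0}) := by
    refine Subset.antisymm ?_ (image_mono inter_subset_right)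
    rintro _ ⟨p, hp, rfl⟩
    have hp : g p = 0 := hp
    have hs := hg.strip hp
    refine ⟨p + (((-⌊p.1⌋ : ℤ) : ℝ), 0), ⟨⟨?_, ?_⟩, ?_⟩, ?_⟩
    · have := Int.floor_le p.1
      have := Int.lt_floor_add_one p.1
      simp only [Prod.fst_add, mem_Icc]; push_cast; constructor <;> linarith
    · simp only [Prod.snd_add, mem_Icc]; constructor <;> linarith
    · change g _ = 0
      rw [hg.perZ, hp]
    · exact ((covProj_eq_iff _ _).2 ⟨_, rfl⟩).symm
  rw [this]
  exact h1.image covProj_continuous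

lemma direction {g : ℝ × ℝ → ℝ} (hg : Good g) {p : ℝ × ℝ} (hp : g p = 0) {v : ℝ × ℝ}
    (hv : 0 < dotp v (tau g p)) : ∃ U ∈ 𝓝 p, ∀ q1 ∈ U, ∀ q2 ∈ U, g q1 = 0 → g q2 = 0 → q1 ≠ q2 →
      0 < dotp v (q2 - q1) * dotp (tau g p) (q2 - q1) := by
  have hn := tau_pos (hg.reg p hp)
  have hstrict := (hg.smooth p hp).hasStrictFDerivAt one_ne_zero
  have hfa := fderiv_apply_eq g p
  obtain ⟨a, ha⟩ : ∃ a, a = fderiv ℝ g p (1, 0) := ⟨_, rfl⟩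
  obtain ⟨b, hb⟩ : ∃ b, b = fderiv ℝ g p (0, 1) := ⟨_, rfl⟩
  simp only [dotp, tau, ← ha, ← hb] at hn hv hfa ⊢
  obtain ⟨n, hnn⟩ : ∃ n, n = a ^ 2 + b ^ 2 := ⟨_, rfl⟩
  have hn0 : 0 < n := by nlinarith
  obtain ⟨N, hN⟩ : ∃ N, N = |a| + |b| := ⟨_, rfl⟩
  have hN0 : 0 < N := by
    rcases (abs_nonneg a).lt_or_eq with h | h
    · rw [hN]; positivity
    · have ha0 : a = 0 := abs_eq_zero.1 h.symm
      have hb0 : b ≠ 0 := by rintro rfl; rw [ha0] at hn; simp at hn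
      rw [hN]; positivity
  obtain ⟨m, hm⟩ : ∃ m, m = |v.1 * a + v.2 * b| := ⟨_, rfl⟩
  have hm0 : 0 ≤ m := hm ▸ abs_nonneg _
  obtain ⟨w, hw⟩ : ∃ w, w = v.1 * b + v.2 * -a := ⟨_, rfl⟩
  rw [← hw] at hv
  -- κ = min (1/2) (w / (4 (m+1)))
  obtain ⟨κ, hκ0, hκ1, hκ2⟩ : ∃ κ : ℝ, 0 < κ ∧ κ ≤ 1/2 ∧ 2 * κ * m < w := by
    refine ⟨min (1/2) (w / (4 * (m + 1))), by positivity, min_le_left _ _, ?_⟩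
    have h1 : min (1/2) (w / (4 * (m + 1))) ≤ w / (4 * (m + 1)) := min_le_right _ _
    have h2 : w / (4 * (m + 1)) * (4 * (m + 1)) = w := by field_simp
    have h3 : 0 < w / (4 * (m + 1)) := by positivity
    nlinarith
  have hc : 0 < κ * n / N := by positivity
  have hev := hstrict.isLittleO.def hc
  rw [nhds_prod_eq] at hev
  obtain ⟨U, hU, hUev'⟩ := Filter.mem_prod_same_iff.1 hev
  have hUev : ∀ x ∈ U, ∀ y ∈ U, ‖g x - g y - (fderiv ℝ g p) (x - y)‖ ≤ κ * n / N * ‖x - y‖ :=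
    fun x hx y hy => hUev' (mk_mem_prod hx hy)
  refine ⟨U, hU, fun q1 h1 q2 h2 hg1 hg2 hne => ?_⟩
  have h := hUev q2 h2 q1 h1
  simp only [hg1, hg2, hfa] at h
  obtain ⟨d, hd⟩ : ∃ d, d = q2 - q1 := ⟨_, rfl⟩
  rw [← hd] at h ⊢
  have hd0 : d ≠ 0 := by rw [hd]; exact sub_ne_zero.2 hne.symm
  rw [Real.norm_eq_abs, sub_self, zero_sub, abs_neg] at h
  obtain ⟨x, hx⟩ : ∃ x, x = b * d.1 + -a * d.2 := ⟨_, rfl⟩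
  obtain ⟨y, hy⟩ : ∃ y, y = d.1 * a + d.2 * b := ⟨_, rfl⟩
  rw [← hy] at h
  rw [← hx]
  have e1 : n * d.1 = b * x + a * y := by rw [hnn, hx, hy]; ring
  have e2 : n * d.2 = -a * x + b * y := by rw [hnn, hx, hy]; ring
  have ax : ∀ s t : ℝ, |s * x + t * y| ≤ |s| * |x| + |t| * |y| := fun s t => by
    rw [← abs_mul, ← abs_mul]; exact abs_add_le _ _
  have hxn := abs_nonneg x
  have hyn := abs_nonneg y
  have han := abs_nonneg a
  have hbn := abs_nonneg b
  have f1 : n * |d.1| ≤ N * (|x| + |y|) := by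
    rw [← abs_of_pos hn0, ← abs_mul, e1]
    refine (ax b a).trans ?_
    rw [hN]; nlinarith [mul_nonneg han hxn, mul_nonneg hbn hyn]
  have f2 : n * |d.2| ≤ N * (|x| + |y|) := by
    rw [← abs_of_pos hn0, ← abs_mul, e2]
    refine (ax (-a) b).trans ?_
    rw [hN, abs_neg]; nlinarith [mul_nonneg hbn hxn, mul_nonneg han hyn]
  have f3 : n * ‖d‖ ≤ N * (|x| + |y|) := by
    rw [Prod.norm_def, Real.norm_eq_abs, Real.norm_eq_abs]
    rcases max_choice |d.1| |d.2| with h | h <;> rw [h] <;> assumption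
  have f4 : |y| ≤ κ * (|x| + |y|) := by
    have : κ * n / N * ‖d‖ = κ / N * (n * ‖d‖) := by ring
    rw [this] at h
    refine h.trans ((mul_le_mul_of_nonneg_left f3 (by positivity)).trans (le_of_eq ?_))
    field_simp
  have f5 : |y| ≤ 2 * κ * |x| := by nlinarith
  have hx0 : x ≠ 0 := by
    intro h0
    have hy0 : y = 0 := by rw [h0] at f5; simpa using f5
    apply hd0
    rw [h0, hy0, mul_zero, mul_zero, add_zero] at e1 e2
    exact Prod.ext ((mul_eq_zero.1 e1).resolve_left hn0.ne') ((mul_eq_zero.1 e2).resolve_left hn0.ne')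
  have e3 : n * (v.1 * d.1 + v.2 * d.2) = x * w + y * (v.1 * a + v.2 * b) := by
    have : n * (v.1 * d.1 + v.2 * d.2) = v.1 * (n * d.1) + v.2 * (n * d.2) := by ring
    rw [this, e1, e2, hw]; ring
  have hx2 : 0 < |x| := abs_pos.2 hx0
  have f6 : |(y * (v.1 * a + v.2 * b)) * x| ≤ (2 * κ * |x|) * m * |x| := by
    rw [abs_mul, abs_mul, ← hm]; gcongr
  have f7 := (abs_le.1 f6).1
  have hxx : |x| * |x| = x * x := abs_mul_abs_self x
  have hxx' : 0 < x * x := by rw [← hxx]; positivity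
  have : 0 < n * ((v.1 * d.1 + v.2 * d.2) * x) := by
    rw [← mul_assoc, e3]
    have f8 : (2 * κ * m) * (x * x) < w * (x * x) := mul_lt_mul_of_pos_right hκ2 hxx'
    have f9 : (2 * κ * |x|) * m * |x| = (2 * κ * m) * (x * x) := by rw [← hxx]; ring
    have f10 : (x * w + y * (v.1 * a + v.2 * b)) * x = w * (x * x) + y * (v.1 * a + v.2 * b) * x := by ring
    rw [f9] at f7
    rw [f10]
    linarith
  exact (pos_iff_pos_of_mul_pos this).1 hn0

/-- forward paths -/
def Fwd (g : ℝ × ℝ → ℝ) (γ : ℝ → ℝ × ℝ) (a b : ℝ) : Prop :=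
  (∀ t ∈ Icc a b, g (γ t) = 0) ∧ ∀ t ∈ Icc a b, ∃ ε > 0, ∀ s1 ∈ Icc a b, ∀ s2 ∈ Icc a b,
    |s1 - t| < ε → |s2 - t| < ε → s1 < s2 → 0 < dotp (tau g (γ t)) (γ s2 - γ s1)

lemma Fwd.translate {g : ℝ × ℝ → ℝ} (hg : Good g) {γ : ℝ → ℝ × ℝ} {a b : ℝ} (h : Fwd g γ a b)
    (n : ℤ) : Fwd g (fun t => γ t + ((n : ℝ), 0)) a b := by
  refine ⟨fun t ht => by rw [hg.perZ]; exact h.1 t ht, fun t ht => ?_⟩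
  obtain ⟨ε, hε, h2⟩ := h.2 t ht
  refine ⟨ε, hε, fun s1 h1 s2 h2' e1 e2 hlt => ?_⟩
  rw [tau_per hg, add_sub_add_right_eq_sub]
  exact h2 s1 h1 s2 h2' e1 e2 hlt

lemma arc {g : ℝ × ℝ → ℝ} (hg : Good g) {p : ℝ × ℝ} (hp : g p = 0) : ∃ U ∈ 𝓝 p, ∃ e, ∀ q ∈ U,
    g q = 0 → ∃ a : ℝ → ℝ × ℝ, Continuous a ∧ Fwd g a 0 1 ∧ a 0 = q ∧ a 1 = e := by
  have hW : {q | 0 < dotp (tau g p) (tau g q)} ∈ 𝓝 p := by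
    have h1 : ContinuousAt (fderiv ℝ g) p := (hg.smooth p hp).continuousAt_fderiv one_ne_zero
    have h2 : ContinuousAt (tau g) p := by
      unfold tau
      exact (h1.clm_apply continuousAt_const).prodMk (h1.clm_apply continuousAt_const).neg
    have h3 : ContinuousAt (fun q => dotp (tau g p) (tau g q)) p :=
      (dotp_continuous _).continuousAt.comp h2
    exact h3.eventually (lt_mem_nhds (tau_pos (hg.reg p hp)))
  obtain ⟨r, hr, σ, U, hU, hUW, hσ, hσU, hσ1, hσ2⟩ := chart hg hp hW
  have hmem : ∀ y : ℝ, |y| < r → (y, (0 : ℝ)) ∈ Metric.ball (0 : ℝ × ℝ) r := by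
    intro y hy; simp [Prod.norm_def, hy]
  have hnb : {q | |dotp (tau g p) (q - p)| < r / 2} ∈ 𝓝 p := by
    have : Continuous fun q => |dotp (tau g p) (q - p)| :=
      ((dotp_continuous (tau g p)).comp (continuous_id.sub continuous_const)).abs
    have h0 : |dotp (tau g p) (p - p)| < r / 2 := by simp [dotp, hr]
    exact this.continuousAt.eventually (gt_mem_nhds h0)
  refine ⟨_, inter_mem hU hnb, σ (r / 2, 0), ?_⟩
  rintro q ⟨hqU, hq⟩ hgq
  have hq : |dotp (tau g p) (q - p)| < r / 2 := hq
  obtain ⟨x, hx⟩ : ∃ x, x = dotp (tau g p) (q - p) := ⟨_, rfl⟩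
  rw [← hx] at hq
  have hq' := abs_lt.1 hq
  let κ : ℝ → ℝ := fun t => max 0 (min 1 t)
  have hκ0 : ∀ t, 0 ≤ κ t := fun t => le_max_left _ _
  have hκ1 : ∀ t, κ t ≤ 1 := fun t => max_le zero_le_one (min_le_left _ _)
  have hκ : ∀ t ∈ Icc (0:ℝ) 1, κ t = t := by
    intro t ht; simp [κ, ht.1, ht.2]
  have hκc : Continuous κ := by fun_prop
  let c : ℝ → ℝ × ℝ := fun t => (x + κ t * (r / 2 - x), 0)
  have hcb : ∀ t, c t ∈ Metric.ball (0 : ℝ × ℝ) r := by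
    intro t
    apply hmem
    rw [abs_lt]
    have := hκ0 t
    have := hκ1 t
    constructor <;> nlinarith
  have hcc : Continuous c := by fun_prop
  have hac : Continuous (fun t => σ (c t)) := hσ.comp_continuous hcc hcb
  have hag : ∀ t, g (σ (c t)) = 0 := fun t => congrArg Prod.snd (hσ1 _ (hcb t))
  refine ⟨fun t => σ (c t), hac, ⟨fun t _ => hag t, fun t ht => ?_⟩, ?_, ?_⟩
  · have hdir : 0 < dotp (tau g p) (tau g (σ (c t))) := hUW (hσU (hcb t))
    obtain ⟨V, hV, hVd⟩ := direction hg (hag t) hdir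
    obtain ⟨ε, hε, hεV⟩ := Metric.mem_nhds_iff.1 (hac.continuousAt.preimage_mem_nhds hV)
    refine ⟨ε, hε, fun s1 h1 s2 h2 e1 e2 hlt => ?_⟩
    have d1 := congrArg Prod.fst (hσ1 _ (hcb s1))
    have d2 := congrArg Prod.fst (hσ1 _ (hcb s2))
    simp only [dotp_sub] at d1 d2
    have hpos : 0 < dotp (tau g p) (σ (c s2) - σ (c s1)) := by
      have : (c s1).1 < (c s2).1 := by
        simp only [c, hκ s1 h1, hκ s2 h2]
        nlinarith
      rw [dotp_sub]
      linarith
    have hne : σ (c s1) ≠ σ (c s2) := by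
      intro h
      rw [h] at hpos; simp [dotp] at hpos
    have := hVd _ (hεV (by rwa [Metric.mem_ball, Real.dist_eq])) _
      (hεV (by rwa [Metric.mem_ball, Real.dist_eq])) (hag s1) (hag s2) hne
    exact (pos_iff_pos_of_mul_pos this).1 hpos
  · have := (hσ2 q hqU).2
    rw [hgq, ← hx] at this
    simp [c, κ, this]
  · simp [c, κ]

lemma arcs {g : ℝ × ℝ → ℝ} (hg : Good g) : ∃ E : Set Cyl, E.Finite ∧ ∀ q, g q = 0 →
    ∃ a : ℝ → ℝ × ℝ, Continuous a ∧ Fwd g a 0 1 ∧ a 0 = q ∧ covProj (a 1) ∈ E := by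
  have key : ∃ E : Set Cyl, E.Finite ∧ ∀ q, covProj q ∈ ZC g →
    ∃ a : ℝ → ℝ × ℝ, Continuous a ∧ Fwd g a 0 1 ∧ a 0 = q ∧ covProj (a 1) ∈ E := by
    refine (ZC_compact hg).induction_on (p := fun S => ∃ E : Set Cyl, E.Finite ∧ ∀ q, covProj q ∈ S →
      ∃ a : ℝ → ℝ × ℝ, Continuous a ∧ Fwd g a 0 1 ∧ a 0 = q ∧ covProj (a 1) ∈ E) ?_ ?_ ?_ ?_
    · exact ⟨∅, finite_empty, fun q hq => hq.elim⟩
    · rintro s t hst ⟨E, hE, h⟩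
      exact ⟨E, hE, fun q hq => h q (hst hq)⟩
    · rintro s t ⟨E, hE, h⟩ ⟨E', hE', h'⟩
      refine ⟨E ∪ E', hE.union hE', ?_⟩
      rintro q (hq | hq)
      · obtain ⟨a, h1, h2, h3, h4⟩ := h q hq
        exact ⟨a, h1, h2, h3, Or.inl h4⟩
      · obtain ⟨a, h1, h2, h3, h4⟩ := h' q hq
        exact ⟨a, h1, h2, h3, Or.inr h4⟩
    · rintro _ ⟨p, hp, rfl⟩
      obtain ⟨U, hU, e, hUe⟩ := arc hg hp
      refine ⟨covProj '' U ∩ ZC g, ?_, {covProj e}, finite_singleton _, ?_⟩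
      · refine inter_mem (mem_nhdsWithin_of_mem_nhds ?_) self_mem_nhdsWithin
        rw [nhds_covProj]; exact image_mem_map hU
      · rintro q ⟨⟨q', hq', hqq⟩, hqZ⟩
        rw [hg.mem_ZC] at hqZ
        obtain ⟨n, rfl⟩ := (covProj_eq_iff _ _).1 hqq
        rw [hg.perZ] at hqZ
        obtain ⟨a, h1, h2, h3, h4⟩ := hUe q' hq' hqZ
        refine ⟨fun t => a t + ((n : ℝ), 0), by fun_prop, h2.translate hg n, by simp [h3], ?_⟩
        rw [mem_singleton_iff, ← h4]
        exact ((covProj_eq_iff _ _).2 ⟨n, rfl⟩).symm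
  obtain ⟨E, hE, h⟩ := key
  exact ⟨E, hE, fun q hq => h q ((hg.mem_ZC q).2 hq)⟩

lemma paths {g : ℝ × ℝ → ℝ} {E : Set Cyl} (hE : ∀ q, g q = 0 →
    ∃ a : ℝ → ℝ × ℝ, Continuous a ∧ Fwd g a 0 1 ∧ a 0 = q ∧ covProj (a 1) ∈ E)
    {q : ℝ × ℝ} (hq : g q = 0) (M : ℕ) :
    ∃ γ : ℝ → ℝ × ℝ, Continuous γ ∧ Fwd g γ 0 M ∧ γ 0 = q ∧
      ∀ k : ℕ, 1 ≤ k → k ≤ M → covProj (γ k) ∈ E := by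
  induction M with
  | zero =>
    refine ⟨fun _ => q, continuous_const, ⟨fun _ _ => hq, fun t _ => ⟨1, one_pos, ?_⟩⟩, rfl, ?_⟩
    · intro s1 h1 s2 h2 _ _ hlt
      have := h1.1; have := h2.2
      simp at this
      linarith
    · intro k h1 h2; omega
  | succ M ih =>
    obtain ⟨γ, hγ, hF, hγ0, hγE⟩ := ih
    have hM : (0 : ℝ) ≤ M := Nat.cast_nonneg M
    obtain ⟨a, ha, hFa, ha0, ha1⟩ := hE (γ M) (hF.1 _ ⟨hM, le_refl _⟩)
    let γ' : ℝ → ℝ × ℝ := fun t => if t ≤ M then γ t else a (t - M)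
    have hγ' : Continuous γ' := by
      refine Continuous.if_le hγ (by fun_prop) continuous_id continuous_const ?_
      rintro t rfl; simp [ha0]
    have hl : ∀ t ≤ (M : ℝ), γ' t = γ t := fun t ht => if_pos ht
    have hr : ∀ t, (M : ℝ) ≤ t → γ' t = a (t - M) := by
      intro t ht
      rcases ht.eq_or_lt with rfl | h
      · rw [hl _ le_rfl]; simp [ha0]
      · exact if_neg (not_le.2 h)
    refine ⟨γ', hγ', ⟨?_, ?_⟩, ?_, ?_⟩
    · intro t ht
      push_cast at ht
      rcases le_total t M with h | h
      · rw [hl t h]; exact hF.1 t ⟨ht.1, h⟩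
      · rw [hr t h]; exact hFa.1 _ ⟨by linarith, by linarith [ht.2]⟩
    · intro t ht
      push_cast at ht ⊢
      rcases lt_trichotomy t M with h | h | h
      · obtain ⟨ε, hε, hh⟩ := hF.2 t ⟨ht.1, h.le⟩
        refine ⟨min ε (M - t), lt_min hε (by linarith), ?_⟩
        intro s1 h1 s2 h2 e1 e2 hlt
        have e1' := (abs_lt.1 (e1.trans_le (min_le_right _ _))).2
        have e2' := (abs_lt.1 (e2.trans_le (min_le_right _ _))).2
        rw [hl t h.le, hl s1 (by linarith), hl s2 (by linarith)]
        exact hh s1 ⟨h1.1, by linarith⟩ s2 ⟨h2.1, by linarith⟩ (e1.trans_le (min_le_left _ _))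
          (e2.trans_le (min_le_left _ _)) hlt
      · obtain ⟨ε, hε, hh⟩ := hF.2 t ⟨ht.1, h.le⟩
        obtain ⟨ε', hε', hh'⟩ := hFa.2 (t - M) ⟨by linarith, by linarith⟩
        refine ⟨min ε ε', lt_min hε hε', ?_⟩
        have eq1 : γ' t = γ t := hl t h.le
        have eq2 : γ' t = a (t - M) := hr t h.ge
        have L1 : ∀ s1 s2 : ℝ, 0 ≤ s1 → s1 < s2 → s2 ≤ M → |s1 - t| < ε → |s2 - t| < ε →
            0 < dotp (tau g (γ' t)) (γ' s2 - γ' s1) := by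
          intro s1 s2 h1 h2 h3 e1 e2
          rw [eq1, hl s1 (by linarith), hl s2 (by linarith)]
          exact hh s1 ⟨h1, by linarith⟩ s2 ⟨by linarith, by linarith⟩ e1 e2 h2
        have L2 : ∀ s1 s2 : ℝ, M ≤ s1 → s1 < s2 → s2 ≤ M + 1 → |s1 - t| < ε' → |s2 - t| < ε' →
            0 < dotp (tau g (γ' t)) (γ' s2 - γ' s1) := by
          intro s1 s2 h1 h2 h3 e1 e2
          rw [eq2, hr s1 (by linarith), hr s2 (by linarith)]
          exact hh' (s1 - M) ⟨by linarith, by linarith⟩ (s2 - M) ⟨by linarith, by linarith⟩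
            (by rwa [sub_sub_sub_cancel_right]) (by rwa [sub_sub_sub_cancel_right]) (by linarith)
        intro s1 h1 s2 h2 e1 e2 hlt
        have e1l := e1.trans_le (min_le_left _ _)
        have e2l := e2.trans_le (min_le_left _ _)
        have e1r := e1.trans_le (min_le_right _ _)
        have e2r := e2.trans_le (min_le_right _ _)
        rcases le_or_gt s2 M with h2M | h2M
        · exact L1 s1 s2 h1.1 hlt h2M e1l e2l
        rcases le_or_gt (M : ℝ) s1 with h1M | h1M
        · exact L2 s1 s2 h1M hlt h2.2 e1r e2r
        have A := L1 s1 M h1.1 h1M le_rfl e1l (by rw [h]; simpa using hε)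
        have B := L2 M s2 le_rfl h2M h2.2 (by rw [h]; simpa using hε') e2r
        rw [dotp_sub] at A B ⊢
        linarith
      · obtain ⟨ε, hε, hh⟩ := hFa.2 (t - M) ⟨by linarith, by linarith [ht.2]⟩
        refine ⟨min ε (t - M), lt_min hε (by linarith), ?_⟩
        intro s1 h1 s2 h2 e1 e2 hlt
        have e1' := (abs_lt.1 (e1.trans_le (min_le_right _ _))).1
        have e2' := (abs_lt.1 (e2.trans_le (min_le_right _ _))).1
        rw [hr t h.le, hr s1 (by linarith), hr s2 (by linarith)]
        refine hh _ ⟨by linarith, by linarith [h1.2]⟩ _ ⟨by linarith, by linarith [h2.2]⟩ ?_ ?_ (by linarith)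
        · rw [sub_sub_sub_cancel_right]; exact (e1.trans_le (min_le_left _ _))
        · rw [sub_sub_sub_cancel_right]; exact (e2.trans_le (min_le_left _ _))
    · rw [hl 0 hM, hγ0]
    · intro k h1 h2
      rcases Nat.lt_or_ge M k with h | h
      · have hk : k = M + 1 := by omega
        subst hk
        rw [hr _ (by push_cast; linarith)]
        push_cast
        simpa using ha1
      · rw [hl _ (by exact_mod_cast h)]
        exact hγE k h1 h



lemma half_right {g : ℝ × ℝ → ℝ} (hg : Good g) {γ : ℝ → ℝ × ℝ} (hγ : Continuous γ) {a b u : ℝ}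
    (hF : Fwd g γ a b) (hu : u ∈ Ico a b) : ∃ N ∈ 𝓝 (γ u), ∀ q ∈ N, g q = 0 →
      0 ≤ dotp (tau g (γ u)) (q - γ u) → q ∈ γ '' Icc u b := by
  have hu' : u ∈ Icc a b := ⟨hu.1, hu.2.le⟩
  obtain ⟨r, hr, σ, U, hU, -, hσ, hσU, hσ1, hσ2⟩ := chart hg (hF.1 u hu') (W := univ) univ_mem
  obtain ⟨ε, hε, hh⟩ := hF.2 u hu'
  obtain ⟨ε', hε', hU'⟩ := Metric.mem_nhds_iff.1 (hγ.continuousAt.preimage_mem_nhds hU)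
  obtain ⟨s, hs1, hs2⟩ := exists_between (show u < min b (min (u + ε) (u + ε')) from
    lt_min hu.2 (lt_min (by linarith) (by linarith)))
  have hsb : s < b := hs2.trans_le (min_le_left _ _)
  have hsε : s < u + ε := hs2.trans_le ((min_le_right _ _).trans (min_le_left _ _))
  have hsε' : s < u + ε' := hs2.trans_le ((min_le_right _ _).trans (min_le_right _ _))
  have hpos := hh u hu' s ⟨by linarith [hu.1], hsb.le⟩ (by simpa using hε)
    (by rw [abs_of_pos] <;> linarith) hs1
  have hcd : Continuous fun q => dotp (tau g (γ u)) (q - γ u) :=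
    (dotp_continuous _).comp (continuous_id.sub continuous_const)
  have hN : {q | dotp (tau g (γ u)) (q - γ u) < dotp (tau g (γ u)) (γ s - γ u)} ∈ 𝓝 (γ u) := by
    refine hcd.continuousAt.eventually (gt_mem_nhds ?_)
    simpa [dotp] using hpos
  refine ⟨_, inter_mem hU hN, ?_⟩
  rintro q ⟨hqU, hq⟩ hgq hq0
  have hivt := intermediate_value_Icc hs1.le (hcd.comp hγ).continuousOn
  obtain ⟨t, ht, hte⟩ := hivt ⟨by simpa [dotp] using hq0, le_of_lt hq⟩
  have hte : dotp (tau g (γ u)) (γ t - γ u) = dotp (tau g (γ u)) (q - γ u) := hte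
  have htU : γ t ∈ U := hU' (by
    rw [Metric.mem_ball, Real.dist_eq, abs_of_nonneg] <;> linarith [ht.1, ht.2])
  have h1 := (hσ2 _ htU).2
  have h2 := (hσ2 _ hqU).2
  rw [hF.1 t ⟨by linarith [ht.1, hu.1], by linarith [ht.2]⟩, hte] at h1
  rw [hgq, h1] at h2
  exact ⟨t, ⟨ht.1, by linarith [ht.2]⟩, h2⟩

lemma half_left {g : ℝ × ℝ → ℝ} (hg : Good g) {γ : ℝ → ℝ × ℝ} (hγ : Continuous γ) {a b u : ℝ}
    (hF : Fwd g γ a b) (hu : u ∈ Ioc a b) : ∃ N ∈ 𝓝 (γ u), ∀ q ∈ N, g q = 0 →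
      dotp (tau g (γ u)) (q - γ u) ≤ 0 → q ∈ γ '' Icc a u := by
  have hu' : u ∈ Icc a b := ⟨hu.1.le, hu.2⟩
  obtain ⟨r, hr, σ, U, hU, -, hσ, hσU, hσ1, hσ2⟩ := chart hg (hF.1 u hu') (W := univ) univ_mem
  obtain ⟨ε, hε, hh⟩ := hF.2 u hu'
  obtain ⟨ε', hε', hU'⟩ := Metric.mem_nhds_iff.1 (hγ.continuousAt.preimage_mem_nhds hU)
  obtain ⟨s, hs2, hs1⟩ := exists_between (show max a (max (u - ε) (u - ε')) < u from
    max_lt hu.1 (max_lt (by linarith) (by linarith)))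
  have hsb : a < s := (le_max_left _ _).trans_lt hs2
  have hsε : u - ε < s := ((le_max_left _ _).trans (le_max_right _ _)).trans_lt hs2
  have hsε' : u - ε' < s := ((le_max_right _ _).trans (le_max_right _ _)).trans_lt hs2
  have hpos := hh s ⟨hsb.le, by linarith [hu.2]⟩ u hu' 
    (by rw [abs_of_neg] <;> linarith) (by simpa using hε) hs1
  have hneg : dotp (tau g (γ u)) (γ s - γ u) < 0 := by
    rw [dotp_sub] at hpos ⊢; linarith
  have hcd : Continuous fun q => dotp (tau g (γ u)) (q - γ u) :=
    (dotp_continuous _).comp (continuous_id.sub continuous_const)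
  have hN : {q | dotp (tau g (γ u)) (γ s - γ u) < dotp (tau g (γ u)) (q - γ u)} ∈ 𝓝 (γ u) := by
    refine hcd.continuousAt.eventually (lt_mem_nhds ?_)
    simpa [dotp] using hneg
  refine ⟨_, inter_mem hU hN, ?_⟩
  rintro q ⟨hqU, hq⟩ hgq hq0
  have hivt := intermediate_value_Icc hs1.le (hcd.comp hγ).continuousOn
  obtain ⟨t, ht, hte⟩ := hivt ⟨le_of_lt hq, by simpa [dotp] using hq0⟩
  have hte : dotp (tau g (γ u)) (γ t - γ u) = dotp (tau g (γ u)) (q - γ u) := hte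
  have htU : γ t ∈ U := hU' (by
    rw [Metric.mem_ball, Real.dist_eq, abs_of_nonpos] <;> linarith [ht.1, ht.2])
  have h1 := (hσ2 _ htU).2
  have h2 := (hσ2 _ hqU).2
  rw [hF.1 t ⟨by linarith [ht.1], by linarith [ht.2, hu.2]⟩, hte] at h1
  rw [hgq, h1] at h2
  exact ⟨t, ⟨by linarith [ht.1], by linarith [ht.2]⟩, h2⟩

lemma exists_loop {g : ℝ × ℝ → ℝ} (hg : Good g) {q : ℝ × ℝ} (hq : g q = 0) :
    ∃ (γ : ℝ → ℝ × ℝ) (s0 t0 M : ℝ), Continuous γ ∧ Fwd g γ 0 M ∧ γ 0 = q ∧ 0 ≤ s0 ∧ s0 < t0 ∧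
      t0 ≤ M ∧ covProj (γ s0) = covProj (γ t0) ∧
      ∀ s ∈ Ico s0 t0, ∀ t ∈ Ico s0 t0, s < t → covProj (γ s) ≠ covProj (γ t) := by
  obtain ⟨E, hE, hEa⟩ := arcs hg
  obtain ⟨γ, hγ, hF, hγ0, hγE⟩ := paths hEa hq (hE.toFinset.card + 1)
  set M := hE.toFinset.card + 1 with hM
  obtain ⟨i, hi, j, hj, hij, heq⟩ := Finset.exists_ne_map_eq_of_card_lt_of_maps_to
    (s := Finset.Icc 1 M) (t := hE.toFinset) (f := fun k : ℕ => covProj (γ k))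
    (by simp [hM]) (by
      intro k hk
      rw [Finset.coe_Icc] at hk
      simpa using hγE k hk.1 hk.2)
  obtain ⟨i, j, hi, hj, hij, heq⟩ : ∃ i j : ℕ, i ≤ M ∧ j ≤ M ∧ i < j ∧ covProj (γ i) = covProj (γ j) := by
    rw [Finset.mem_Icc] at hi hj
    rcases hij.lt_or_gt with h | h
    · exact ⟨i, j, hi.2, hj.2, h, heq⟩
    · exact ⟨j, i, hj.2, hi.2, h, heq.symm⟩
  have hloc : ∀ t ∈ Icc (0:ℝ) M, ∃ ε > 0, ∀ s1 ∈ Icc (0:ℝ) M, ∀ s2 ∈ Icc (0:ℝ) M, |s1 - t| < ε →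
      |s2 - t| < ε → s1 < s2 → covProj (γ s1) ≠ covProj (γ s2) := by
    intro t ht
    obtain ⟨ε, hε, hh⟩ := hF.2 t ht
    obtain ⟨ε', hε', hh'⟩ := Metric.continuousAt_iff.1 (hγ.continuousAt (x := t)) (1/2) (by norm_num)
    refine ⟨min ε ε', lt_min hε hε', fun s1 h1 s2 h2 e1 e2 hlt heq => ?_⟩
    have A := hh s1 h1 s2 h2 (e1.trans_le (min_le_left _ _)) (e2.trans_le (min_le_left _ _)) hlt
    have B1 := hh' (x := s1) (by rw [Real.dist_eq]; exact e1.trans_le (min_le_right _ _))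
    have B2 := hh' (x := s2) (by rw [Real.dist_eq]; exact e2.trans_le (min_le_right _ _))
    obtain ⟨n, hn⟩ := (covProj_eq_iff _ _).1 heq
    have B : dist (γ s1) (γ s2) < 1 := by
      have := dist_triangle_right (γ s1) (γ s2) (γ t)
      linarith
    have hn0 : |(n : ℝ)| < 1 := by
      rw [hn, dist_self_add_right] at B
      exact (norm_fst_le _).trans_lt B
    have : n = 0 := by
      have h3 : |n| < 1 := by exact_mod_cast hn0
      exact Int.abs_lt_one_iff.1 h3
    rw [hn, this] at A
    simp [dotp] at A
  choose! ε hε hh using hloc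
  obtain ⟨η, hη, hleb⟩ := lebesgue_number_lemma_of_metric (isCompact_Icc (a := (0:ℝ)) (b := M))
    (c := fun t : Icc (0:ℝ) M => Metric.ball (t : ℝ) (ε t)) (fun _ => Metric.isOpen_ball)
    (fun t ht => mem_iUnion.2 ⟨⟨t, ht⟩, Metric.mem_ball_self (hε t ht)⟩)
  have hloc : ∀ s1 ∈ Icc (0:ℝ) M, ∀ s2 ∈ Icc (0:ℝ) M, s1 < s2 → s2 - s1 < η →
      covProj (γ s1) ≠ covProj (γ s2) := by
    intro s1 h1 s2 h2 hlt hd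
    obtain ⟨⟨t, ht⟩, hsub⟩ := hleb s1 h1
    have A := hsub (Metric.mem_ball_self hη)
    have B := hsub (a := s2) (by rw [Metric.mem_ball, Real.dist_eq, abs_of_pos] <;> linarith)
    rw [Metric.mem_ball, Real.dist_eq] at A B
    exact hh t ht s1 h1 s2 h2 A B hlt
  let P : Set (ℝ × ℝ) := (Icc (0:ℝ) M ×ˢ Icc (0:ℝ) M) ∩
    ({x | η ≤ x.2 - x.1} ∩ {x | covProj (γ x.1) = covProj (γ x.2)})
  have hcp := covProj_continuous
  have hPc : IsCompact P := by
    refine (isCompact_Icc.prod isCompact_Icc).inter_right ?_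
    have c1 : IsClosed {x : ℝ × ℝ | η ≤ x.2 - x.1} := isClosed_le (by fun_prop) (by fun_prop)
    have c2 : IsClosed {x : ℝ × ℝ | covProj (γ x.1) = covProj (γ x.2)} :=
      isClosed_eq (by fun_prop) (by fun_prop)
    exact c1.inter c2
  have hiM : (i : ℝ) ∈ Icc (0:ℝ) M := ⟨Nat.cast_nonneg _, by exact_mod_cast hi⟩
  have hjM : (j : ℝ) ∈ Icc (0:ℝ) M := ⟨Nat.cast_nonneg _, by exact_mod_cast hj⟩
  have hijR : (i : ℝ) < j := by exact_mod_cast hij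
  have hPne : P.Nonempty := by
    refine ⟨((i : ℝ), (j : ℝ)), ⟨hiM, hjM⟩, ?_, heq⟩
    by_contra hlt
    exact hloc i hiM j hjM hijR (not_le.1 hlt) heq
  obtain ⟨⟨s0, t0⟩, ⟨⟨hs0, ht0⟩, hst, hstp⟩, hmin⟩ := hPc.exists_isMinOn hPne
    (f := fun x : ℝ × ℝ => x.2 - x.1) (by fun_prop)
  simp only [mem_ofPred_eq] at hs0 ht0 hst hstp
  refine ⟨γ, s0, t0, M, hγ, hF, hγ0, hs0.1, by linarith, ht0.2, hstp, ?_⟩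
  intro s hs t ht hlt heq
  have hsM : s ∈ Icc (0:ℝ) M := ⟨by linarith [hs.1, hs0.1], by linarith [hs.2, ht0.2]⟩
  have htM : t ∈ Icc (0:ℝ) M := ⟨by linarith [ht.1, hs0.1], by linarith [ht.2, ht0.2]⟩
  by_cases hd : t - s < η
  · exact hloc s hsM t htM hlt hd heq
  · have := hmin (show (s, t) ∈ P from ⟨⟨hsM, htM⟩, not_lt.1 hd, heq⟩)
    simp only [mem_ofPred_eq] at this
    linarith [hs.1, ht.2]

lemma component_circle {g : ℝ × ℝ → ℝ} (hg : Good g) {z : Cyl} (hz : z ∈ ZC g) :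
    (∃ γ : C(AddCircle (1 : ℝ), ↥annA), (Set.range fun t => ((γ t : Cyl))) =
      connectedComponentIn (ZC g) z ∧ Function.Injective γ) ∧
    IsClosed (connectedComponentIn (ZC g) z) ∧
    IsClosed (ZC g \ connectedComponentIn (ZC g) z) := by
  obtain ⟨q, hq, rfl⟩ := hz
  obtain ⟨γ, s0, t0, M, hγ, hF, hγ0, hs0, hst, ht0, hper, hinj⟩ := exists_loop hg hq
  have hcp := covProj_continuous
  have hsub : Icc s0 t0 ⊆ Icc 0 M := Icc_subset_Icc hs0 ht0
  let R : Set Cyl := (fun t => covProj (γ t)) '' Icc s0 t0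
  have hRc : IsCompact R := isCompact_Icc.image (by fun_prop)
  have hRconn : IsPreconnected R := isPreconnected_Icc.image _ (by fun_prop)
  have hRZ : R ⊆ ZC g := by
    rintro _ ⟨t, ht, rfl⟩
    exact (hg.mem_ZC _).2 (hF.1 t (hsub ht))
  have hright : ∀ u ∈ Ico s0 t0, ∃ N ∈ 𝓝 (γ u), ∀ q ∈ N, g q = 0 →
      0 ≤ dotp (tau g (γ u)) (q - γ u) → covProj q ∈ R := by
    intro u hu
    have hF' : Fwd g γ s0 t0 := ⟨fun t ht => hF.1 t (hsub ht), fun t ht => by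
      obtain ⟨ε, hε, h⟩ := hF.2 t (hsub ht)
      exact ⟨ε, hε, fun s1 h1 s2 h2 => h s1 (hsub h1) s2 (hsub h2)⟩⟩
    obtain ⟨N, hN, h⟩ := half_right hg hγ hF' hu
    refine ⟨N, hN, fun q hq hgq hd => ?_⟩
    obtain ⟨t, ht, rfl⟩ := h q hq hgq hd
    exact ⟨t, ⟨hu.1.trans ht.1, ht.2⟩, rfl⟩
  have hleft : ∀ u ∈ Ioc s0 t0, ∃ N ∈ 𝓝 (γ u), ∀ q ∈ N, g q = 0 →
      dotp (tau g (γ u)) (q - γ u) ≤ 0 → covProj q ∈ R := by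
    intro u hu
    have hF' : Fwd g γ s0 t0 := ⟨fun t ht => hF.1 t (hsub ht), fun t ht => by
      obtain ⟨ε, hε, h⟩ := hF.2 t (hsub ht)
      exact ⟨ε, hε, fun s1 h1 s2 h2 => h s1 (hsub h1) s2 (hsub h2)⟩⟩
    obtain ⟨N, hN, h⟩ := half_left hg hγ hF' hu
    refine ⟨N, hN, fun q hq hgq hd => ?_⟩
    obtain ⟨t, ht, rfl⟩ := h q hq hgq hd
    exact ⟨t, ⟨ht.1, ht.2.trans hu.2⟩, rfl⟩
  -- the left side also at the starting point
  obtain ⟨n, hn⟩ := (covProj_eq_iff _ _).1 hper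
  have hleft' : ∀ u ∈ Ico s0 t0, ∃ N ∈ 𝓝 (γ u), ∀ q ∈ N, g q = 0 →
      dotp (tau g (γ u)) (q - γ u) ≤ 0 → covProj q ∈ R := by
    intro u hu
    rcases hu.1.eq_or_lt with rfl | h
    · obtain ⟨N, hN, h⟩ := hleft t0 ⟨hst, le_rfl⟩
      rw [hn] at hN h
      have hcont : Continuous fun q : ℝ × ℝ => q + ((n : ℝ), (0:ℝ)) := by fun_prop
      refine ⟨_, hcont.continuousAt.preimage_mem_nhds hN, fun q hq hgq hd => ?_⟩
      have := h _ hq (by rw [hg.perZ, hgq]) (by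
        rw [tau_per hg, add_sub_add_right_eq_sub]; exact hd)
      rwa [← (covProj_eq_iff q _).2 ⟨n, rfl⟩] at this
    · exact hleft u ⟨h, hu.2.le⟩
  have hRico : ∀ x ∈ R, ∃ u ∈ Ico s0 t0, covProj (γ u) = x := by
    rintro _ ⟨t, ht, rfl⟩
    rcases ht.2.eq_or_lt with rfl | h
    · exact ⟨s0, ⟨le_rfl, hst⟩, hper⟩
    · exact ⟨t, ⟨ht.1, h⟩, rfl⟩
  have hRopen : ∀ x ∈ R, ∀ᶠ y in 𝓝 x, y ∈ ZC g → y ∈ R := by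
    intro x hx
    obtain ⟨u, hu, rfl⟩ := hRico x hx
    obtain ⟨N, hN, h⟩ := hright u hu
    obtain ⟨N', hN', h'⟩ := hleft' u hu
    rw [nhds_covProj, Filter.eventually_map]
    filter_upwards [hN, hN'] with q hq hq' hqZ
    rw [hg.mem_ZC] at hqZ
    rcases le_total 0 (dotp (tau g (γ u)) (q - γ u)) with h0 | h0
    · exact h q hq hqZ h0
    · exact h' q hq' hqZ h0
  have hdiff : IsClosed (ZC g \ R) := by
    rw [← isOpen_compl_iff, isOpen_iff_mem_nhds]
    intro x hx
    by_cases hxR : x ∈ R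
    · filter_upwards [hRopen x hxR] with y hy hy'
      exact hy'.2 (hy hy'.1)
    · have hxZ : x ∉ ZC g := fun h => hx ⟨h, hxR⟩
      filter_upwards [(ZC_compact hg).isClosed.isOpen_compl.mem_nhds hxZ] with y hy hy'
      exact hy hy'.1
  have hs0R : covProj (γ s0) ∈ R := ⟨s0, ⟨le_rfl, hst.le⟩, rfl⟩
  have hq0 : covProj q ∈ ZC g := (hg.mem_ZC q).2 hq
  have hs0C : covProj (γ s0) ∈ connectedComponentIn (ZC g) (covProj q) := by
    have hM0 : (0:ℝ) ≤ M := by linarith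
    have hpre : IsPreconnected ((fun t => covProj (γ t)) '' Icc 0 M) :=
      isPreconnected_Icc.image _ (by fun_prop)
    refine hpre.subset_connectedComponentIn ⟨0, ⟨le_rfl, hM0⟩, by simp [hγ0]⟩ ?_
      ⟨s0, ⟨hs0, by linarith⟩, rfl⟩
    rintro _ ⟨t, ht, rfl⟩
    exact (hg.mem_ZC _).2 (hF.1 t ht)
  have hRC : R = connectedComponentIn (ZC g) (covProj q) := by
    apply Subset.antisymm
    · rw [connectedComponentIn_eq hs0C]
      exact hRconn.subset_connectedComponentIn hs0R hRZ
    · intro x hx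
      by_contra hxR
      obtain ⟨y, -, hy1, hy2⟩ := isPreconnected_closed_iff.1 isPreconnected_connectedComponentIn R (ZC g \ R)
        hRc.isClosed hdiff (fun y hy => by
          by_cases h : y ∈ R
          · exact Or.inl h
          · exact Or.inr ⟨connectedComponentIn_subset _ _ hy, h⟩) ⟨_, hs0C, hs0R⟩
        ⟨x, hx, connectedComponentIn_subset _ _ hx, hxR⟩
      exact hy2.2 hy1
  rw [← hRC]
  refine ⟨?_, hRc.isClosed, hdiff⟩
  -- the loop
  have hannA : ∀ x ∈ ZC g, x ∈ annA := by
    rintro _ ⟨p, hp, rfl⟩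
    exact ⟨mem_univ _, (hg.strip hp).1.le, (hg.strip hp).2.le⟩
  let κ : ℝ → ℝ := fun t => s0 + max 0 (min 1 t) * (t0 - s0)
  have hκm : ∀ t, κ t ∈ Icc s0 t0 := by
    intro t
    have h0 : 0 ≤ max 0 (min 1 t) := le_max_left _ _
    have h1 : max 0 (min 1 t) ≤ 1 := max_le zero_le_one (min_le_left _ _)
    constructor <;> simp only [κ] <;> nlinarith
  have hκe : ∀ t ∈ Icc (0:ℝ) 1, κ t = s0 + t * (t0 - s0) := by
    intro t ht; simp [κ, ht.1, ht.2]
  let f : ℝ → annA := fun t => ⟨covProj (γ (κ t)), hannA _ (hRZ ⟨κ t, hκm t, rfl⟩)⟩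
  have hf : Continuous f := by
    refine Continuous.subtype_mk ?_ _
    have : Continuous κ := by fun_prop
    fun_prop
  have hf01 : f 0 = f (0 + 1) := by
    apply Subtype.ext
    simp only [f]
    rw [hκe 0 (by simp), hκe (0 + 1) (by simp)]
    simp [hper]
  have := Fact.mk (zero_lt_one (α := ℝ))
  let Γ : C(AddCircle (1:ℝ), annA) := ⟨AddCircle.liftIco 1 0 f, by
    apply AddCircle.liftIco_continuous
    · exact hf01
    · exact hf.continuousOn⟩
  have hΓ : ∀ t ∈ Ico (0:ℝ) 1, Γ (t : AddCircle (1:ℝ)) = f t := by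
    intro t ht
    have ht2 : t ∈ Ico (0:ℝ) (0 + 1) := by simpa using ht
    have h3 : AddCircle.liftIco (1:ℝ) 0 f (t : AddCircle (1:ℝ)) = f t :=
      AddCircle.liftIco_coe_apply ht2
    exact h3
  have hsurj : ∀ x : AddCircle (1:ℝ), ∃ t ∈ Ico (0:ℝ) 1, (t : AddCircle (1:ℝ)) = x := by
    intro x
    have := AddCircle.coe_image_Ico_eq (1:ℝ) 0
    have hx : x ∈ ((↑) : ℝ → AddCircle (1:ℝ)) '' Ico 0 (0 + 1) := this ▸ mem_univ x
    obtain ⟨t, ht, rfl⟩ := hx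
    exact ⟨t, by simpa using ht, rfl⟩
  refine ⟨Γ, ?_, ?_⟩
  · ext x
    constructor
    · rintro ⟨y, rfl⟩
      obtain ⟨t, ht, rfl⟩ := hsurj y
      simp only [hΓ t ht]
      exact ⟨κ t, hκm t, rfl⟩
    · intro hx
      obtain ⟨u, hu, rfl⟩ := hRico x hx
      have hd : 0 < t0 - s0 := by linarith
      have ht : (u - s0) / (t0 - s0) ∈ Ico (0:ℝ) 1 :=
        ⟨div_nonneg (by linarith [hu.1]) hd.le, by rw [div_lt_one hd]; linarith [hu.2]⟩
      refine ⟨(((u - s0) / (t0 - s0) : ℝ) : AddCircle (1:ℝ)), ?_⟩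
      simp only [hΓ _ ht, f]
      rw [hκe _ ⟨ht.1, ht.2.le⟩, div_mul_cancel₀ _ hd.ne']
      congr 2; ring
  · intro x y hxy
    obtain ⟨s, hs, rfl⟩ := hsurj x
    obtain ⟨t, ht, rfl⟩ := hsurj y
    rw [hΓ s hs, hΓ t ht] at hxy
    have hxy : covProj (γ (κ s)) = covProj (γ (κ t)) := congrArg Subtype.val hxy
    rw [hκe s ⟨hs.1, hs.2.le⟩, hκe t ⟨ht.1, ht.2.le⟩] at hxy
    have hd : 0 < t0 - s0 := by linarith
    have hm : ∀ t ∈ Ico (0:ℝ) 1, s0 + t * (t0 - s0) ∈ Ico s0 t0 := by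
      intro t ht
      have := ht.1; have := ht.2
      constructor <;> nlinarith
    rcases lt_trichotomy s t with h | h | h
    · exact absurd hxy (hinj _ (hm s hs) _ (hm t ht) (by nlinarith))
    · rw [h]
    · exact absurd hxy.symm (hinj _ (hm t ht) _ (hm s hs) (by nlinarith))



lemma comps_finite {g : ℝ × ℝ → ℝ} (hg : Good g) :
    (connectedComponentIn (ZC g) '' ZC g).Finite := by
  refine (ZC_compact hg).induction_on (p := fun S => (connectedComponentIn (ZC g) '' S).Finite) ?_ ?_ ?_ ?_
  · simp
  · intro s t hst h; exact h.subset (image_mono hst)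
  · intro s t hs ht; rw [image_union]; exact hs.union ht
  · intro z hz
    obtain ⟨-, -, h⟩ := component_circle hg hz
    refine ⟨ZC g ∩ (ZC g \ connectedComponentIn (ZC g) z)ᶜ, ?_, ?_⟩
    · refine inter_mem self_mem_nhdsWithin (mem_nhdsWithin_of_mem_nhds ?_)
      exact h.isOpen_compl.mem_nhds (fun hh => hh.2 (mem_connectedComponentIn hz))
    · refine (finite_singleton (connectedComponentIn (ZC g) z)).subset ?_
      rintro _ ⟨y, ⟨hy1, hy2⟩, rfl⟩
      have hy : y ∈ connectedComponentIn (ZC g) z := by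
        by_contra hn; exact hy2 ⟨hy1, hn⟩
      exact (connectedComponentIn_eq hy).symm

lemma core {g : ℝ × ℝ → ℝ} (hg : Good g) :
    {C | (∃ z ∈ ZC g, C = connectedComponentIn (ZC g) z) ∧ IsEssential C}.Finite ∧
    Odd {C | (∃ z ∈ ZC g, C = connectedComponentIn (ZC g) z) ∧ IsEssential C}.ncard := by
  classical
  have hfin := comps_finite hg
  let T := hfin.toFinset
  have hT : ∀ C, C ∈ T ↔ ∃ z ∈ ZC g, C = connectedComponentIn (ZC g) z := by
    intro C; simp only [T, Set.Finite.mem_toFinset, mem_image]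
    exact ⟨fun ⟨z, h1, h2⟩ => ⟨z, h1, h2.symm⟩, fun ⟨z, h1, h2⟩ => ⟨z, h1, h2.symm⟩⟩
  have hZdiff : ∀ C, C ∈ T → IsClosed ({p | g p = 0} \ covProj ⁻¹' C) := by
    intro C hC
    obtain ⟨z, hz, rfl⟩ := (hT C).1 hC
    obtain ⟨-, -, h⟩ := component_circle hg hz
    convert! h.preimage covProj_continuous using 1
    ext p
    simp only [Set.mem_sdiff, mem_preimage, hg.mem_ZC, mem_ofPred_eq]
  have hex : ∀ C, C ∈ T → ∃ H : ℝ × ℝ → ℤ, Jump g (covProj ⁻¹' C) H := by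
    intro C hC
    have h1 := hZdiff C hC
    obtain ⟨z, hz, rfl⟩ := (hT C).1 hC
    obtain ⟨-, h2, -⟩ := component_circle hg hz
    refine exists_jump hg.cont (h2.preimage covProj_continuous) ?_ h1
    intro p hp
    exact (hg.mem_ZC p).1 (connectedComponentIn_subset _ _ hp)
  choose! H hH using hex
  have hsum : Jump g {q | g q = 0} (fun q => ∑ C ∈ T, H C q) := by
    intro p
    have hall : ∀ᶠ q in 𝓝 p, ∀ C ∈ T, H C q - H C p = if p ∈ covProj ⁻¹' C then sgnI g q else 0 :=
      (Filter.eventually_all_finset T).2 fun C hC => hH C hC p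
    filter_upwards [hall] with q hq
    rw [← Finset.sum_sub_distrib, Finset.sum_congr rfl hq]
    by_cases hp : g p = 0
    · rw [if_pos hp]
      have hpZ := (hg.mem_ZC p).2 hp
      rw [Finset.sum_eq_single (connectedComponentIn (ZC g) (covProj p))]
      · exact if_pos (mem_connectedComponentIn hpZ)
      · intro C hC hne
        rw [if_neg]
        intro hpC
        obtain ⟨z, hz, rfl⟩ := (hT C).1 hC
        exact hne (connectedComponentIn_eq hpC)
      · intro h; exact absurd ((hT _).2 ⟨_, hpZ, rfl⟩) h
    · rw [if_neg hp]
      apply Finset.sum_eq_zero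
      intro C hC
      rw [if_neg]
      intro hpC
      obtain ⟨z, hz, rfl⟩ := (hT C).1 hC
      exact hp ((hg.mem_ZC p).1 (connectedComponentIn_subset _ _ hpC))
  let k : Set Cyl → ℤ := fun C => H C (0, 1) - H C (0, 0)
  have hk1 : ∑ C ∈ T, k C = 1 := by
    have := hsum.sub_const (jump_sgn hg.cont) (0, 1) (0, 0)
    have e1 : sgnI g (0, 1) = 1 := if_pos (hg.high _ le_rfl)
    have e0 : sgnI g (0, 0) = 0 := if_neg (not_lt.2 (hg.low _ le_rfl).le)
    simp only [e1, e0] at this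
    simp only [k, Finset.sum_sub_distrib]
    omega
  have hk2 : ∀ C ∈ T, k C = -1 ∨ k C = 0 ∨ k C = 1 := by
    intro C hC
    have hJ := hH C hC
    obtain ⟨z, hz, rfl⟩ := (hT C).1 hC
    obtain ⟨c, -, h⟩ := hJ.two hg isPreconnected_connectedComponentIn
      (connectedComponentIn_subset _ _) ⟨z, mem_connectedComponentIn hz⟩
    have h1 := h (0, 1)
    have h0 := h (0, 0)
    simp only [k]
    omega
  have hk3 : ∀ C ∈ T, (k C ≠ 0 ↔ IsEssential C) := by
    intro C hC
    have hJ := hH C hC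
    have hZC := hZdiff C hC
    obtain ⟨z, hz, hCz⟩ := (hT C).1 hC
    obtain ⟨⟨γ, hγ1, hγ2⟩, hcl, -⟩ := component_circle hg hz
    rw [← hCz] at hγ1 hcl
    have hCZ : C ⊆ ZC g := by rw [hCz]; exact connectedComponentIn_subset _ _
    have hconn : IsConnected C := by
      rw [hCz]; exact isConnected_connectedComponentIn_iff.2 hz
    constructor
    · intro hk
      refine ⟨γ, hγ1, hγ2, fun hnull => hk ?_⟩
      have := null_jump hg hCZ hZC γ hγ1 hγ2 hnull hJ
      simp only [k]; omega
    · rintro ⟨δ, hδ1, hδ2, hδ3⟩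
      obtain ⟨L, w, hL, hLδ, hLw⟩ := loop_lift δ
      have hw : w ≠ 0 := by
        rintro rfl
        apply hδ3
        obtain ⟨ξ, hξ, hξL⟩ := descend (ℓ := fun t => (L t).1) (by fun_prop) (fun t => by simp [hLw])
        refine nullhomotopic_of_lift δ ξ hξ fun t => ?_
        obtain ⟨t, rfl⟩ := QuotientAddGroup.mk_surjective t
        have e1 : ξ (t : AddCircle (1:ℝ)) = (L t).1 := hξL t
        have e2 := congrArg Prod.fst (hLδ t)
        change ((ξ (t : AddCircle (1:ℝ)) : ℝ) : AddCircle (1:ℝ)) = (δ (t : AddCircle (1:ℝ)) : Cyl).1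
        rw [e1, ← e2]; rfl
      have := jump_ne hg hconn hcl hCZ hZC hJ hL hw hLw (fun t => by
        rw [hLδ, ← hδ1]; exact ⟨_, rfl⟩)
      simp only [k]; omega
  have hset : {C | (∃ z ∈ ZC g, C = connectedComponentIn (ZC g) z) ∧ IsEssential C} =
      ((T.filter fun C => k C ≠ 0 : Finset (Set Cyl)) : Set (Set Cyl)) := by
    ext C
    simp only [mem_ofPred_eq, Finset.coe_filter]
    rw [← hT]
    exact ⟨fun ⟨h1, h2⟩ => ⟨h1, (hk3 C h1).2 h2⟩, fun ⟨h1, h2⟩ => ⟨h1, (hk3 C h1).1 h2⟩⟩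
  rw [hset]
  refine ⟨Finset.finite_toSet _, ?_⟩
  rw [Set.ncard_coe_finset]
  have hpar : (2 : ℤ) ∣ ∑ C ∈ T, (k C - if k C ≠ 0 then 1 else 0) := by
    apply Finset.dvd_sum
    intro C hC
    rcases hk2 C hC with h | h | h <;> simp [h]
  rw [Finset.sum_sub_distrib, hk1, Finset.sum_boole] at hpar
  have h2 : Odd (((T.filter fun C => k C ≠ 0).card : ℕ) : ℤ) := by
    rw [Int.odd_iff]
    push_cast at hpar ⊢
    omega
  exact_mod_cast h2

lemma good_of_twist (F : ℝ × ℝ → ℝ × ℝ)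
    (hper : ∀ p ∈ stripA, F (p.1 + 1, p.2) = ((F p).1 + 1, (F p).2))
    (hFC1 : ContDiffOn ℝ 1 F stripA)
    (hbdry0 : ∀ x : ℝ, (F (x, 0)).2 = 0)
    (hbdry1 : ∀ x : ℝ, (F (x, 1)).2 = 1)
    (htwist0 : ∀ x : ℝ, (F (x, 0)).1 < x)
    (htwist1 : ∀ x : ℝ, x < (F (x, 1)).1)
    (φ : ℝ) (hφ : 0 < φ)
    (hreg : ∀ p ∈ stripA, Fphi F φ p = 0 → fderivWithin ℝ (Fphi F φ) stripA p ≠ 0) :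
    ∃ g, Good g ∧ zeroSetA F φ = ZC g := by
  let κ : ℝ × ℝ → ℝ × ℝ := fun p => (p.1, max 0 (min 1 p.2))
  have hκc : Continuous κ := by fun_prop
  have hκs : ∀ p, κ p ∈ stripA := fun p =>
    ⟨mem_univ _, le_max_left _ _, max_le zero_le_one (min_le_left _ _)⟩
  have hκe : ∀ p ∈ stripA, κ p = p := by
    rintro p ⟨-, h1, h2⟩
    ext <;> simp [κ, h1, h2]
  have hFp : ContDiffOn ℝ 1 (Fphi F φ) stripA := by
    unfold Fphi
    fun_prop
  let g : ℝ × ℝ → ℝ := fun p => Fphi F φ (κ p)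
  have hge : ∀ p ∈ stripA, g p = Fphi F φ p := fun p hp => by simp only [g, hκe p hp]
  have hlow : ∀ p : ℝ × ℝ, p.2 ≤ 0 → g p < 0 := by
    intro p hp
    have : κ p = (p.1, 0) := by ext <;> simp [κ, hp]
    simp only [g, this, Fphi, hbdry0]
    nlinarith [htwist0 p.1]
  have hhigh : ∀ p : ℝ × ℝ, 1 ≤ p.2 → 0 < g p := by
    intro p hp
    have : κ p = (p.1, 1) := by ext <;> simp [κ, hp]
    simp only [g, this, Fphi, hbdry1]
    nlinarith [htwist1 p.1]
  have hin : ∀ p, g p = 0 → stripA ∈ 𝓝 p := by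
    intro p hp
    have h0 : 0 < p.2 := by by_contra h; exact (hlow p (not_lt.1 h)).ne hp
    have h1 : p.2 < 1 := by by_contra h; exact (hhigh p (not_lt.1 h)).ne' hp
    exact prod_mem_nhds univ_mem (Icc_mem_nhds h0 h1)
  have hev : ∀ p, g p = 0 → g =ᶠ[𝓝 p] Fphi F φ := fun p hp => by
    filter_upwards [hin p hp] with q hq using hge q hq
  refine ⟨g, ⟨?_, ?_, hlow, hhigh, ?_, ?_⟩, ?_⟩
  · exact hFp.continuousOn.comp_continuous hκc hκs
  · intro p
    have h1 : κ (p + (1, 0)) = ((κ p).1 + 1, (κ p).2) := by ext <;> simp [κ]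
    simp only [g, h1, Fphi, hper _ (hκs p)]
    ring
  · intro p hp
    exact (hFp.contDiffAt (hin p hp)).congr_of_eventuallyEq (hev p hp)
  · intro p hp
    have hps := mem_of_mem_nhds (hin p hp)
    rw [(hev p hp).fderiv_eq, ← fderivWithin_of_mem_nhds (hin p hp)]
    exact hreg p hps (by rw [← hge p hps, hp])
  · unfold zeroSetA ZC
    congr 1
    ext p
    constructor
    · rintro ⟨h1, h2⟩
      change g p = 0
      rw [hge p h1, h2]
    · intro h
      have h : g p = 0 := h
      have hps := mem_of_mem_nhds (hin p h)
      exact ⟨hps, by rw [← hge p hps, h]⟩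


end Helpers

/-- If `0` is a regular value of `F_φ` on `A`, then the number of essential (i.e. not
null-homotopic, equivalently of winding number `±1`) connected components of the zero set
`Z = F_φ⁻¹(0) ⊆ A` is odd; in particular there is at least one essential component. -/
theorem odd_number_of_essential_components
    (f : Cyl → Cyl) (F G : ℝ × ℝ → ℝ × ℝ)
    -- `F` is a lift of `f`: `π ∘ f̃ = f ∘ π`
    (hlift : ∀ p ∈ stripA, covProj (F p) = f (covProj p))
    -- equivariance of the lift: `f̃(x+1, y) = f̃(x, y) + (1, 0)`
    (hper : ∀ p ∈ stripA, F (p.1 + 1, p.2) = ((F p).1 + 1, (F p).2))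
    -- `f` is a C¹ diffeomorphism (through its lift): C¹, bijective on the strip,
    -- with a C¹ inverse lift `G`
    (hFC1 : ContDiffOn ℝ 1 F stripA)
    (hFbij : Set.BijOn F stripA stripA)
    (hGC1 : ContDiffOn ℝ 1 G stripA)
    (hGmaps : Set.MapsTo G stripA stripA)
    (hGF : ∀ p ∈ stripA, G (F p) = p)
    (hFG : ∀ p ∈ stripA, F (G p) = p)
    -- each boundary component is mapped to itself
    (hbdry0 : ∀ x : ℝ, (F (x, 0)).2 = 0)
    (hbdry1 : ∀ x : ℝ, (F (x, 1)).2 = 1)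
    -- twist condition for the normalized lift
    (htwist0 : ∀ x : ℝ, (F (x, 0)).1 < x)
    (htwist1 : ∀ x : ℝ, x < (F (x, 1)).1)
    (φ : ℝ) (hφ : 0 < φ)
    -- `0` is a regular value of `F_φ`
    (hreg : ∀ p ∈ stripA, Fphi F φ p = 0 → fderivWithin ℝ (Fphi F φ) stripA p ≠ 0) :
    (essentialComponents F φ).Finite ∧ Odd (essentialComponents F φ).ncard ∧
    (essentialComponents F φ).Nonempty := by
  obtain ⟨g, hg, hz⟩ := good_of_twist F hper hFC1 hbdry0 hbdry1 htwist0 htwist1 φ hφ hreg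
  obtain ⟨h1, h2⟩ := core hg
  have he : essentialComponents F φ = {C | (∃ z ∈ ZC g, C = connectedComponentIn (ZC g) z) ∧
      IsEssential C} := by
    unfold essentialComponents
    rw [hz]
  rw [← he] at h1 h2
  refine ⟨h1, h2, ?_⟩
  by_contra hne
  rw [Set.not_nonempty_iff_eq_empty] at hne
  rw [hne, Set.ncard_empty] at h2
  exact absurd h2 (by decide)
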